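/- Let α be a weak composition and φ a flag. If φ is strictly increasing, then κ_(α,φ) = κ_β, where β_j = α_i if j = φ(i) for some i and β_j = 0 otherwise. If φ is not strictly increasing and i is the smallest index with φ(i) = φ(i+1), then κ_(α,φ) = κ_(α, φ−e_i) when α_i ≤ α_{i+1}, and κ_(α,φ) = κ_(α·s_i, φ−e_i) when α_i > α_{i+1}. -/

import Mathlib

noncomputable section
attribute [local instance] Classical.propDecidable

/-! ### Words, permutations, reduced words -/

/-- The adjacent transposition `s_i` exchanging `i` and `i+1`. -/
def sPerm (i : ℕ) : Equiv.Perm ℕ := Equiv.swap i (i + 1)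

/-- The permutation `s_{i_1} ⋯ s_{i_n}` represented by the word `i_1 ⋯ i_n`. -/
def wordPerm (ρ : List ℕ) : Equiv.Perm ℕ := (ρ.map sPerm).prod

/-- A word whose letters are positive integers. -/
def PosWord (ρ : List ℕ) : Prop := ∀ x ∈ ρ, 1 ≤ x

/-- A reduced word: a word of positive integers of minimal length among all words of
positive integers representing the same permutation. -/
def IsReducedWord (ρ : List ℕ) : Prop :=
  PosWord ρ ∧ ∀ σ : List ℕ, PosWord σ → wordPerm σ = wordPerm ρ → ρ.length ≤ σ.length

/-- `ρ` is a reduced word for the permutation `w`. -/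
def IsReducedWordFor (w : Equiv.Perm ℕ) (ρ : List ℕ) : Prop :=
  IsReducedWord ρ ∧ wordPerm ρ = w

/-- A member of `S∞`: a permutation of the positive integers (it fixes `0`)
fixing all but finitely many points. -/
def FinitaryPerm (w : Equiv.Perm ℕ) : Prop := w 0 = 0 ∧ {i : ℕ | w i ≠ i}.Finite

/-- A flag: a weakly increasing function `φ : ℤ_{>0} → ℤ_{>0}` with `φ(n) ≥ n`. -/
def IsFlag (φ : ℕ → ℕ) : Prop :=
  (∀ m n : ℕ, 1 ≤ m → m ≤ n → φ m ≤ φ n) ∧ ∀ n : ℕ, 1 ≤ n → n ≤ φ n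

/-- A weak composition, as a function on the positive integers (value `0` at `0`)
with finitely many nonzero entries. -/
def WeakComp (α : ℕ → ℕ) : Prop := α 0 = 0 ∧ {i : ℕ | α i ≠ 0}.Finite

/-- `φ - e_i`, i.e. `l ↦ φ(l) - δ_{il}`. -/
def subE (φ : ℕ → ℕ) (i : ℕ) : ℕ → ℕ := fun l => if l = i then φ l - 1 else φ l

/-- The right action of `s_i` on weak compositions, swapping entries `i` and `i+1`. -/
def swapC (α : ℕ → ℕ) (i : ℕ) : ℕ → ℕ := fun j => α (sPerm i j)

/-- `α` has length `k`: `k` is minimal with `α i = 0` for all `i > k`. -/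
def HasLen (α : ℕ → ℕ) (k : ℕ) : Prop :=
  (∀ i, k < i → α i = 0) ∧ ∀ m, (∀ i, m < i → α i = 0) → k ≤ m

/-! ### Coxeter–Knuth equivalence -/

/-- One Coxeter–Knuth move. -/
def CKStep (u v : List ℕ) : Prop :=
  (∃ (a b : List ℕ) (x y z : ℕ), y < x ∧ x < z ∧
      u = a ++ [x, y, z] ++ b ∧ v = a ++ [x, z, y] ++ b) ∨
  (∃ (a b : List ℕ) (x y z : ℕ), y < z ∧ z < x ∧
      u = a ++ [x, y, z] ++ b ∧ v = a ++ [y, x, z] ++ b) ∨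
  (∃ (a b : List ℕ) (i : ℕ),
      u = a ++ [i, i + 1, i] ++ b ∧ v = a ++ [i + 1, i, i + 1] ++ b)

/-- Coxeter–Knuth equivalence: the transitive (symmetric, reflexive) closure of `CKStep`. -/
def CKEquiv : List ℕ → List ℕ → Prop := Relation.EqvGen CKStep

/-! ### Run factorizations and weak descent tableaux -/

/-- The run factorization of a word into maximal strictly increasing blocks
(listed from left to right). -/
def runFact : List ℕ → List (List ℕ)
  | [] => []
  | a :: rest =>
    match runFact rest with
    | [] => [[a]]
    | r :: rs => if a < r.headI then (a :: r) :: rs else [a] :: r :: rs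

/-- Auxiliary: rows of the remaining blocks, given the row of the previous block. -/
def wdtRowsAux : ℤ → List (List ℕ) → List ℤ
  | _, [] => []
  | prev, b :: bs =>
      min (prev - 1) (b.headI : ℤ) :: wdtRowsAux (min (prev - 1) (b.headI : ℤ)) bs

/-- The row indices assigned to the blocks of a run factorization (blocks listed
left to right): the leftmost block goes to the row indexed by its first letter, and each
subsequent block goes to the row indexed by its first letter if this is below the previous
block's row, and otherwise directly below the previous block's row. -/
def wdtRows : List (List ℕ) → List ℤ
  | [] => []
  | b :: bs => (b.headI : ℤ) :: wdtRowsAux (b.headI : ℤ) bs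

/-- A tableau: rows indexed by `ℤ` (bottom to top), columns indexed by `ℕ` starting at `1`;
the value `0` means that there is no box, a nonzero value is the (positive) entry. -/
abbrev Tableau := ℤ → ℕ → ℕ

/-- The weak descent tableau of a word. -/
def weakDesTab (ρ : List ℕ) : Tableau := fun r c =>
  if c = 0 then 0
  else
    match ((wdtRows (runFact ρ)).zip (runFact ρ)).find? (fun p => decide (p.1 = r)) with
    | some p => p.2.getD (c - 1) 0
    | none => 0

/-- A word is non-virtual if its weak descent tableau only occupies rows of positive index. -/
def NonVirtual (ρ : List ℕ) : Prop := ∀ r ∈ wdtRows (runFact ρ), 1 ≤ r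

/-- The shape of a tableau: the number of boxes in each (positively indexed) row. -/
def shapeOf (T : Tableau) : ℕ → ℕ := fun i => Set.ncard {c : ℕ | T (i : ℤ) c ≠ 0}

/-- The weak descent composition of a word: the shape of its weak descent tableau. -/
def desComp (ρ : List ℕ) : ℕ → ℕ := shapeOf (weakDesTab ρ)

/-- Partial-sum (dominance) order on weak compositions. -/
def compLE (μ ν : ℕ → ℕ) : Prop :=
  ∀ k : ℕ, ∑ i ∈ Finset.Icc 1 k, μ i ≤ ∑ i ∈ Finset.Icc 1 k, ν i

/-- A Yamanouchi reduced word: a non-virtual reduced word that is minimal in its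
Coxeter–Knuth class among non-virtual words, for the order
`ρ ≤ τ ↔ ρ ~ τ ∧ des ρ ≤ des τ`. -/
def Yamanouchi (ρ : List ℕ) : Prop :=
  IsReducedWord ρ ∧ NonVirtual ρ ∧
    ∀ σ : List ℕ, NonVirtual σ → CKEquiv ρ σ → compLE (desComp ρ) (desComp σ)

/-- The (unique) Yamanouchi reduced word Coxeter–Knuth equivalent to `ρ`. -/
def hatRho (ρ : List ℕ) : List ℕ :=
  if h : ∃ σ, Yamanouchi σ ∧ CKEquiv ρ σ then h.choose else []

/-- The weak Edelman–Greene insertion tableau of a word: the weak descent tableau of the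
unique Yamanouchi reduced word Coxeter–Knuth equivalent to it. -/
def hatP (ρ : List ℕ) : Tableau := weakDesTab (hatRho ρ)

/-! ### Factorizations -/

/-- The factorization `f : ℕ → List ℕ` stores the block `ρ^{(i)}` at index `i ≥ 1`
(blocks indexed from the right); the largest index of a nonempty block. -/
def topIdx (f : ℕ → List ℕ) : ℕ := sSup {i : ℕ | f i ≠ []}

/-- The concatenation `ρ^{(top)} ⋯ ρ^{(i+1)} ρ^{(i)}` of the blocks of `f` with index `≥ i`. -/
def factWordGe (f : ℕ → List ℕ) (i : ℕ) : List ℕ :=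
  ((((List.range (topIdx f + 1)).reverse).filter (fun j => decide (i ≤ j))).map f).foldr
    (· ++ ·) []

/-- The underlying word of a factorization. -/
def factWord (f : ℕ → List ℕ) : List ℕ := factWordGe f 0

/-- The weak Edelman–Greene recording tableau of a factorization: it has the same shape as
the weak EG insertion tableau of the underlying word, and has entry `i` in all boxes of
`P̂(ρ^{(k)}|⋯|ρ^{(i)})` that are not in `P̂(ρ^{(k)}|⋯|ρ^{(i+1)})`. -/
def hatQfact (f : ℕ → List ℕ) : Tableau := fun r c =>
  sSup {i : ℕ | 1 ≤ i ∧ hatP (factWordGe f i) r c ≠ 0 ∧ hatP (factWordGe f (i + 1)) r c = 0}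

/-- Every block is strictly increasing. -/
def IncreasingFact (f : ℕ → List ℕ) : Prop := ∀ i, List.Chain' (· < ·) (f i)

/-- The factorization is `φ`-flagged: every nonempty block `ρ^{(i)}` has first letter
`ρ^{(i)}_1` with `φ(ρ^{(i)}_1) ≥ i`. -/
def FlaggedFact (φ : ℕ → ℕ) (f : ℕ → List ℕ) : Prop :=
  ∀ i, f i ≠ [] → i ≤ φ ((f i).headI)

/-- `RFC(w, φ)`: all `φ`-flagged increasing factorizations of reduced words for `w`. -/
def RFCset (w : Equiv.Perm ℕ) (φ : ℕ → ℕ) : Set (ℕ → List ℕ) :=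
  {f | f 0 = [] ∧ {i : ℕ | f i ≠ []}.Finite ∧ IncreasingFact f ∧ FlaggedFact φ f ∧
       IsReducedWordFor w (factWord f)}

/-- `RF_n(w)`: increasing factorizations of reduced words for `w` with exactly `n` blocks
(indexed `1, …, n`, possibly empty). -/
def RFn (n : ℕ) (w : Equiv.Perm ℕ) : Set (ℕ → List ℕ) :=
  {f | f 0 = [] ∧ (∀ j, n < j → f j = []) ∧ IncreasingFact f ∧
       IsReducedWordFor w (factWord f)}

/-- `RFC_n(w, φ)`: the `φ`-flagged elements of `RF_n(w)`. -/
def RFCn (n : ℕ) (w : Equiv.Perm ℕ) (φ : ℕ → ℕ) : Set (ℕ → List ℕ) :=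
  {f | f ∈ RFn n w ∧ FlaggedFact φ f}

/-! ### Morse–Schilling crystal operators -/

/-- Pairing procedure: first argument is the block `r^{(i)}` in *decreasing* order, second is
the not-yet-paired part of the block `r^{(i+1)}` (in increasing order). Each letter `b` of
`r^{(i)}`, from largest to smallest, is paired with the smallest still unpaired letter of
`r^{(i+1)}` strictly larger than `b`. Returns the unpaired letters of `r^{(i+1)}`. -/
def unpairedUpper : List ℕ → List ℕ → List ℕ
  | [], A => A
  | b :: bs, A =>
    match A.find? (fun a => decide (b < a)) with
    | some a => unpairedUpper bs (A.erase a)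
    | none => unpairedUpper bs A

/-- As in `unpairedUpper`, but returns the unpaired letters of `r^{(i)}`. -/
def unpairedLower : List ℕ → List ℕ → List ℕ
  | [], _ => []
  | b :: bs, A =>
    match A.find? (fun a => decide (b < a)) with
    | some a => unpairedLower bs (A.erase a)
    | none => b :: unpairedLower bs A

/-- Insert a letter into a weakly increasing list, keeping it increasing. -/
def insAsc (x : ℕ) : List ℕ → List ℕ
  | [] => [x]
  | y :: ys => if x ≤ y then x :: y :: ys else y :: insAsc x ys

/-- The Morse–Schilling raising operator `e_i`: if every letter of block `i+1` is paired,
the result is `none` (i.e. `0`); otherwise the largest unpaired letter `a` of block `i+1` is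
removed and `a + s` is added to block `i`, where `s = min {j ≥ 0 | a+j+1 ∉ r^{(i+1)}}`. -/
def msE (i : ℕ) (f : ℕ → List ℕ) : Option (ℕ → List ℕ) :=
  let B := f i
  let A := f (i + 1)
  let L := unpairedUpper B.reverse A
  if L = [] then none
  else
    let a := L.foldr max 0
    let s := sInf {j : ℕ | (a + j + 1) ∉ A}
    some (Function.update (Function.update f (i + 1) (A.erase a)) i (insAsc (a + s) B))

/-- The Morse–Schilling lowering operator `f_i`: if every letter of block `i` is paired,
the result is `none`; otherwise the smallest unpaired letter `b` of block `i` is removed and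
`b - t` is added to block `i+1`, where `t = min {j ≥ 0 | b-j-1 ∉ r^{(i)}}`. -/
def msF (i : ℕ) (f : ℕ → List ℕ) : Option (ℕ → List ℕ) :=
  let B := f i
  let A := f (i + 1)
  let R := unpairedLower B.reverse A
  if R = [] then none
  else
    let b := R.foldr min R.headI
    let t := sInf {j : ℕ | (b - j - 1) ∉ B}
    some (Function.update (Function.update f i (B.erase b)) (i + 1) (insAsc (b - t) A))

/-- Iteration `e_j^k` of the raising operator. -/
def msEIter (j : ℕ) : ℕ → (ℕ → List ℕ) → Option (ℕ → List ℕ)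
  | 0, f => some f
  | k + 1, f => (msE j f).bind (msEIter j k)

/-- The Demazure operator `𝔇_j` on subsets of the crystal `RF_n(w)`:
`𝔇_j X = {b ∈ RF_n(w) | e_j^k(b) ∈ X for some k ≥ 0}`. -/
def demOp (n : ℕ) (w : Equiv.Perm ℕ) (j : ℕ) (X : Set (ℕ → List ℕ)) : Set (ℕ → List ℕ) :=
  {b | b ∈ RFn n w ∧ ∃ (k : ℕ) (c : ℕ → List ℕ), msEIter j k b = some c ∧ c ∈ X}

/-- `𝔇_{i_1} 𝔇_{i_2} ⋯ 𝔇_{i_k} X` for a word `i_1 i_2 ⋯ i_k` (the head is applied last). -/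
def demWord (n : ℕ) (w : Equiv.Perm ℕ) : List ℕ → Set (ℕ → List ℕ) → Set (ℕ → List ℕ)
  | [], X => X
  | j :: rest, X => demOp n w j (demWord n w rest X)

/-- `𝔇_{b↓a} = 𝔇_{b-1} 𝔇_{b-2} ⋯ 𝔇_a` (the identity when `b ≤ a`). -/
def demDown (n : ℕ) (w : Equiv.Perm ℕ) (b a : ℕ) (X : Set (ℕ → List ℕ)) :
    Set (ℕ → List ℕ) :=
  demWord n w ((List.range' a (b - a)).reverse) X

/-! ### Key tableaux -/

/-- A key tableau: a filling of a left-justified diagram in the positively indexed rows,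
with positive entries, weakly decreasing rows, distinct column entries, and the key
condition (c) of Assaf–Schilling. -/
def IsKeyTableau (T : Tableau) : Prop :=
  (∀ (r : ℤ) (c : ℕ), r ≤ 0 → T r c = 0) ∧
  (∀ r : ℤ, T r 0 = 0) ∧
  {p : ℤ × ℕ | T p.1 p.2 ≠ 0}.Finite ∧
  (∀ (r : ℤ) (c : ℕ), 1 ≤ c → T r (c + 1) ≠ 0 → T r c ≠ 0) ∧
  (∀ (r : ℤ) (c : ℕ), 1 ≤ c → T r (c + 1) ≠ 0 → T r (c + 1) ≤ T r c) ∧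
  (∀ (r r' : ℤ) (c : ℕ), r ≠ r' → T r c ≠ 0 → T r' c ≠ 0 → T r c ≠ T r' c) ∧
  (∀ (r r' : ℤ) (c : ℕ), r < r' → T r c ≠ 0 → T r' c ≠ 0 → T r' c < T r c →
      T r (c + 1) ≠ 0 ∧ T r' c < T r (c + 1))

/-- The tableau is `φ`-flagged: every entry in row `i` is at most `φ(i)`. -/
def FlaggedTab (φ : ℕ → ℕ) (T : Tableau) : Prop := ∀ (i c : ℕ), T (i : ℤ) c ≤ φ i

/-- `SSKT(α, φ)`: the `φ`-flagged key tableaux of shape `α`. -/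
def SSKT (α φ : ℕ → ℕ) : Set Tableau :=
  {T | IsKeyTableau T ∧ shapeOf T = α ∧ FlaggedTab φ T}

/-- The weight of a tableau: `wt(T)_v` is the number of entries equal to `v`. -/
def wtTab (T : Tableau) : ℕ → ℕ := fun v =>
  if v = 0 then 0 else Set.ncard {p : ℤ × ℕ | T p.1 p.2 = v}

/-- The weight of a word: the multiplicity of each positive letter. -/
def wtWord (u : List ℕ) : ℕ → ℕ := fun v => if v = 0 then 0 else u.count v

/-- The statistic `m_i(col(T), j)` where position `j` of the reverse column reading word
(entries read down columns, from right to left) is the box in row `r`, column `c`: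
the number of entries `i+1` weakly after this box minus the number of entries `i`. -/
def mi (T : Tableau) (i : ℕ) (r : ℤ) (c : ℕ) : ℤ :=
  (Set.ncard {p : ℤ × ℕ | T p.1 p.2 = i + 1 ∧ (p.2 < c ∨ (p.2 = c ∧ p.1 ≤ r))} : ℤ) -
  (Set.ncard {p : ℤ × ℕ | T p.1 p.2 = i ∧ (p.2 < c ∨ (p.2 = c ∧ p.1 ≤ r))} : ℤ)

/-- The box `(r, c)` maximizes `m_i` among all boxes of `T`. -/
def isMaxBox (T : Tableau) (i : ℕ) (r : ℤ) (c : ℕ) : Prop :=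
  T r c ≠ 0 ∧ ∀ (r' : ℤ) (c' : ℕ), T r' c' ≠ 0 → mi T i r' c' ≤ mi T i r c

/-- The Assaf–Schilling raising operator `e_i` on key tableaux.  If `m_i(col(T)) ≤ 0` the
result is `none` (i.e. `0`); otherwise, with `q` the largest position of the reverse column
reading word achieving the maximum (i.e. the maximizing box with the smallest column index,
and the smallest row index in that column), all entries `i+1` in the row of `q` weakly to its
right are changed to `i`, and all entries `i` in the same columns as these entries are
changed to `i+1`. -/
def keyE (i : ℕ) (T : Tableau) : Option Tableau :=
  if h : ∃ (r : ℤ) (c : ℕ), isMaxBox T i r c ∧ 1 ≤ mi T i r c then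
    let cq := sInf {c : ℕ | ∃ r : ℤ, isMaxBox T i r c}
    let rq : ℤ := ((sInf {m : ℕ | isMaxBox T i ((m : ℕ) : ℤ) cq} : ℕ) : ℤ)
    some (fun r c =>
      if cq ≤ c ∧ T rq c = i + 1 then
        (if T r c = i + 1 then i else if T r c = i then i + 1 else T r c)
      else T r c)
  else none

/-- The Assaf–Schilling lowering operator `f_i`: the (unique) inverse of `e_i`. -/
def keyF (i : ℕ) (T : Tableau) : Option Tableau :=
  if h : ∃ T', keyE i T' = some T then some h.choose else none

/-- Restriction of a partially defined crystal operator to a subset: the operator returns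
`none` (i.e. `0`) whenever it would leave the subset. -/
def restrictOp {β : Type} (S : Set β) (op : β → Option β) (x : β) : Option β :=
  (op x).bind fun y => if y ∈ S then some y else none

/-! ### Polynomials: divided differences and key polynomials -/

/-- The divided difference operator `∂_i f = (f - s_i · f) / (x_i - x_{i+1})`. -/
def divDiff (i : ℕ) (fp : MvPolynomial ℕ ℤ) : MvPolynomial ℕ ℤ :=
  if h : ∃ g : MvPolynomial ℕ ℤ,
      g * (MvPolynomial.X i - MvPolynomial.X (i + 1)) =
        fp - MvPolynomial.rename (fun j => sPerm i j) fp
  then h.choose else 0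

/-- The isobaric divided difference operator `π_i f = ∂_i (x_i f)`. -/
def piOp (i : ℕ) (fp : MvPolynomial ℕ ℤ) : MvPolynomial ℕ ℤ :=
  divDiff i (MvPolynomial.X i * fp)

/-- `π_{i_1} π_{i_2} ⋯ π_{i_k} f` for a word `i_1 i_2 ⋯ i_k` (the head is applied last). -/
def piWord : List ℕ → MvPolynomial ℕ ℤ → MvPolynomial ℕ ℤ
  | [], fp => fp
  | i :: rest, fp => piOp i (piWord rest fp)

/-- `π_{b↓a} = π_{b-1} π_{b-2} ⋯ π_a` (the identity when `b ≤ a`). -/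
def piDown (b a : ℕ) (fp : MvPolynomial ℕ ℤ) : MvPolynomial ℕ ℤ :=
  piWord ((List.range' a (b - a)).reverse) fp

/-- The conjugate of a weak composition: `conjC α t = #{j ≥ 1 | α_j ≥ t}` for `t ≥ 1`. -/
def conjC (α : ℕ → ℕ) (t : ℕ) : ℕ :=
  Set.ncard {j : ℕ | 1 ≤ j ∧ 1 ≤ t ∧ t ≤ α j}

/-- The partition rearrangement of a weak composition (the conjugate of its conjugate). -/
def sortC (α : ℕ → ℕ) : ℕ → ℕ := conjC (conjC α)

/-- The length of a permutation: the common length of its reduced words. -/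
def permLength (w : Equiv.Perm ℕ) : ℕ :=
  sInf {n : ℕ | ∃ ρ : List ℕ, PosWord ρ ∧ wordPerm ρ = w ∧ ρ.length = n}

/-- The monomial `x^β = x_1^{β_1} x_2^{β_2} ⋯`. -/
def xExp (β : ℕ → ℕ) : MvPolynomial ℕ ℤ :=
  ∏ i ∈ Finset.range (sSup {n : ℕ | β n ≠ 0} + 1), MvPolynomial.X i ^ β i

/-- The key polynomial `κ_α = π_w x^λ` where `λ` is the partition rearrangement of `α` and
`w` is the minimal-length permutation of `S∞` with `α · w = λ`. -/
def keyPoly (α : ℕ → ℕ) : MvPolynomial ℕ ℤ :=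
  if h : ∃ (ρ : List ℕ) (w : Equiv.Perm ℕ), IsReducedWordFor w ρ ∧
      (∀ i, α (w i) = sortC α i) ∧
      (∀ v : Equiv.Perm ℕ, (∃ τ, IsReducedWordFor v τ) → (∀ i, α (v i) = sortC α i) →
        permLength w ≤ permLength v)
  then piWord h.choose (xExp (sortC α)) else 0

/-- The `φ`-flagged key polynomial `κ_{(α,φ)} = Σ_{T ∈ SSKT(α,φ)} x^{wt(T)}`. -/
def flaggedKeyPoly (α φ : ℕ → ℕ) : MvPolynomial ℕ ℤ :=
  ∑ᶠ T ∈ SSKT α φ, xExp (wtTab T)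

/-! ### Column insertion, keys, standardization -/

/-- The number of boxes in column `c` of a tableau. -/
def colHeightN (T : Tableau) (c : ℕ) : ℕ := Set.ncard {r : ℤ | T r c ≠ 0}

/-- One pass of column insertion: insert the value `x` starting at column `c`
(`fuel` bounds the number of columns visited). -/
def colInsertAux : ℕ → Tableau → ℕ → ℕ → Tableau
  | 0, T, _, _ => T
  | fuel + 1, T, c, x =>
    if ∀ r : ℤ, T r c ≠ 0 → T r c < x then
      -- x is greater than every entry of column c: place it at the end of the column
      fun r c' => if c' = c ∧ r = (colHeightN T c + 1 : ℤ) then x else T r c'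
    else if ∃ r : ℤ, T r c = x then
      -- column c contains x: move on to the next column with the same value
      colInsertAux fuel T (c + 1) x
    else
      -- bump the smallest entry of column c that is larger than x
      let y := sInf {v : ℕ | x < v ∧ ∃ r : ℤ, T r c = v}
      colInsertAux fuel (fun r c' => if c' = c ∧ T r c' = y then x else T r c') (c + 1) y

/-- Column insertion of `x` into the semistandard Young tableau `T`. -/
def colInsert (T : Tableau) (x : ℕ) : Tableau :=
  colInsertAux (sSup {c : ℕ | ∃ r : ℤ, T r c ≠ 0} + 2) T 1 x

/-- The insertion tableau `P` of `(v → ∅)`: successively column insert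
`v_n, v_{n-1}, …, v_1` into the empty tableau. -/
def insertP (v : List ℕ) : Tableau :=
  v.reverse.foldl colInsert (fun _ _ => 0)

/-- The recording tableau `Q` of `(v → ∅)`: the standard Young tableau whose restriction to
`{1, …, j}` has the same shape as the insertion tableau of the last `j` letters of `v`. -/
def insertQ (v : List ℕ) : Tableau := fun r c =>
  sInf {j : ℕ | insertP (v.drop (v.length - j)) r c ≠ 0}

/-- The key `key(α)`: the unique semistandard Young tableau of weight `α` such that the set
of entries of column `i+1` is a subset of the entries of column `i`; its column `c` consists
of the elements of `{x ≥ 1 | α_x ≥ c}` in increasing order from bottom to top. -/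
def keyTab (α : ℕ → ℕ) : Tableau := fun r c =>
  if c = 0 then 0
  else sInf {x : ℕ | 1 ≤ x ∧ c ≤ α x ∧
    ((Set.ncard {y : ℕ | 1 ≤ y ∧ c ≤ α y ∧ y ≤ x} : ℕ) : ℤ) = r}

/-- The standardization of a semistandard Young tableau: the `1`'s are replaced from left to
right by `1, …, β_1`, the `2`'s by `β_1 + 1, …, β_1 + β_2`, and so on. -/
def stdTab (T : Tableau) : Tableau := fun r c =>
  if T r c = 0 then 0
  else Set.ncard {p : ℤ × ℕ |
    T p.1 p.2 ≠ 0 ∧ (T p.1 p.2 < T r c ∨ (T p.1 p.2 = T r c ∧ p.2 ≤ c))}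

/-! ### Maximal factorizations (Reiner–Shimozono) -/

/-- Every block is weakly increasing. -/
def WeaklyIncrFact (g : ℕ → List ℕ) : Prop := ∀ i, List.Chain' (· ≤ ·) (g i)

/-- Maximality: the nonempty blocks have maximal length, i.e. there is a strict descent
between any two consecutive nonempty blocks (no letter can be moved from the end of a block
to the front of the next one to the right). -/
def MaxFact (g : ℕ → List ℕ) : Prop :=
  ∀ i j : ℕ, 1 ≤ i → i < j → g i ≠ [] → g j ≠ [] → (∀ m, i < m → m < j → g m = []) →
    (g i).headI < (g j).getLastD 0

/-- Reiner–Shimozono's set `𝒲(α, φ)` of `φ`-flagged maximal factorizations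
`u^• = u^n ⋯ u^2 u^1` with `ℓ(u^i) = α_i` and `(u → ∅) = (P, std(key(α)))`. -/
def Wset (α φ : ℕ → ℕ) : Set (ℕ → List ℕ) :=
  {g | g 0 = [] ∧ (∀ i, (g i).length = α i) ∧ (∀ i, ∀ x ∈ g i, 1 ≤ x) ∧
       WeaklyIncrFact g ∧ MaxFact g ∧ (∀ i, ∀ x ∈ g i, x ≤ φ i) ∧
       insertQ (factWord g) = stdTab (keyTab α)}

/-! ### Shifts and highest weight key tableaux -/

/-- `shift_N`: add `N` to every letter of every block. -/
def shiftFact (N : ℕ) (f : ℕ → List ℕ) : ℕ → List ℕ := fun i => (f i).map (· + N)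

/-- The tableau of shape `α` whose column `i` is filled by `1, 2, …, λ^T_i` in increasing
order from bottom to top (where `λ^T` is the conjugate of the partition rearrangement `λ`
of `α`): the box of column `c` in row `m` (where `α_m ≥ c`) contains the number of indices
`m' ≤ m` with `α_{m'} ≥ c`. -/
def highKeyTab (α : ℕ → ℕ) : Tableau := fun r c =>
  if c = 0 then 0
  else if ∃ m : ℕ, (m : ℤ) = r ∧ 1 ≤ m ∧ c ≤ α m then
    Set.ncard {m : ℕ | 1 ≤ m ∧ c ≤ α m ∧ (m : ℤ) ≤ r}
  else 0


/-- A `gl_n`-crystal isomorphism between two sets of key tableaux, both equipped with the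
Assaf–Schilling operators (restricted to the sets): a weight-preserving bijection commuting
with all raising and lowering operators `e_i, f_i` for `1 ≤ i < n`. -/
def SSKTIso (n : ℕ) (S₁ S₂ : Set Tableau) : Prop :=
  ∃ g : Tableau → Tableau, Set.BijOn g S₁ S₂ ∧
    (∀ T ∈ S₁, wtTab T = wtTab (g T)) ∧
    ∀ T ∈ S₁, ∀ i : ℕ, 1 ≤ i → i < n →
      Option.map g (restrictOp S₁ (keyE i) T) = restrictOp S₂ (keyE i) (g T) ∧
      Option.map g (restrictOp S₁ (keyF i) T) = restrictOp S₂ (keyF i) (g T)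

section KeyChains

variable {ι V R : Type*} [LinearOrder ι] [LinearOrder V] [OrderBot V]

/-- The nonempty entries of a column are distinct (`⊥` marks an empty position). -/
def ColumnDistinct (w : ι → V) : Prop := ∀ r r', r ≠ r' → w r ≠ ⊥ → w r ≠ w r'

/-- The column `w`, occupying the rows in `p`, may follow the column `u` in a key tableau. -/
structure KeyStep (p : ι → Prop) (u w : ι → V) : Prop where
  support : ∀ r, w r ≠ ⊥ ↔ p r
  le : ∀ r, w r ≤ u r
  distinct : ColumnDistinct w
  key : ∀ i k, i < k → u k ≠ ⊥ → u k < u i → u k < w i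

/-- The letter `a` occurs in the column `w`, in a row below any occurrence of `b`. -/
def OccursBelow (a b : V) (w : ι → V) : Prop := ∃ r, w r = a ∧ ∀ k, w k = b → r < k

variable [DecidableEq V] {a b : V} {p : ι → Prop} {u w : ι → V}

lemma swap_eq_bot_iff (ha : a ≠ ⊥) (hb : b ≠ ⊥) (v : V) : Equiv.swap a b v = ⊥ ↔ v = ⊥ := by
  rw [Equiv.swap_apply_def]
  split_ifs <;> simp_all

lemma swap_le_of_covBy (h : a ⋖ b) {v x : V} (hv : v ≤ x) (hx : x ≠ a) :
    Equiv.swap a b v ≤ x := by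
  rw [Equiv.swap_apply_def]
  split_ifs with h1 h2
  · subst h1
    exact h.ge_of_gt (lt_of_le_of_ne hv hx.symm)
  · subst h2
    exact h.lt.le.trans hv
  · exact hv

lemma lt_swap_of_covBy (h : a ⋖ b) {v x : V} (hv : x < v) (hx : x ≠ a) :
    x < Equiv.swap a b v := by
  rw [Equiv.swap_apply_def]
  split_ifs with h1 h2
  · subst h1
    exact hv.trans h.lt
  · subst h2
    exact lt_of_le_of_ne (h.le_of_lt hv) hx
  · exact hv

lemma ColumnDistinct.swap (ha : a ≠ ⊥) (hb : b ≠ ⊥) (hw : ColumnDistinct w) :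
    ColumnDistinct (fun r => Equiv.swap a b (w r)) := by
  intro r r' hr h0 he
  exact hw r r' hr (fun h => h0 ((swap_eq_bot_iff ha hb _).2 h)) ((Equiv.swap a b).injective he)

lemma occursBelow_swap : OccursBelow a b (fun r => Equiv.swap a b (w r)) ↔ OccursBelow b a w := by
  have h1 : ∀ r, Equiv.swap a b (w r) = a ↔ w r = b := fun r => by
    rw [Equiv.swap_apply_eq_iff, Equiv.swap_apply_left]
  have h2 : ∀ r, Equiv.swap a b (w r) = b ↔ w r = a := fun r => by
    rw [Equiv.swap_apply_eq_iff, Equiv.swap_apply_right]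
  simp only [OccursBelow, h1, h2]

lemma not_occursBelow_symm (h : OccursBelow a b w) : ¬ OccursBelow b a w := by
  rintro ⟨r, hr, h'⟩
  obtain ⟨k, hk, h⟩ := h
  exact lt_asymm (h r hr) (h' k hk)

lemma occursBelow_or (ha : a ≠ ⊥) (hab : a ≠ b) (hw : ColumnDistinct w)
    (h : ¬ ∀ r, w r ≠ a ∧ w r ≠ b) : OccursBelow a b w ∨ OccursBelow b a w := by
  unfold OccursBelow ColumnDistinct at *
  push Not at h
  obtain ⟨r, hr⟩ := h
  by_cases hra : w r = a
  · by_cases hb : ∃ k, w k = b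
    · obtain ⟨k, hk⟩ := hb
      rcases lt_trichotomy r k with h1 | h1 | h1
      · grind
      · grind
      · grind
    · grind
  · grind

/-- Exchanging the adjacent letters `a` and `b` in a column. -/
lemma KeyStep.swap (h : a ⋖ b) (ha : a ≠ ⊥) (hw : KeyStep p u w)
    (h1 : ∀ r, u r = a → w r ≠ a) (h2 : ∀ i k, i < k → u k = a → a < u i → w i ≠ b) :
    KeyStep p u (fun r => Equiv.swap a b (w r)) where
  support r := by
    rw [← hw.support r, Ne, swap_eq_bot_iff ha (ne_bot_of_gt h.lt)]
  le r := by
    by_cases hr : u r = a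
    · have h3 := hw.le r
      rw [Equiv.swap_apply_of_ne_of_ne (h1 r hr)]
      · exact h3
      · rintro h4
        rw [hr, h4] at h3
        exact absurd h.lt h3.not_gt
    · exact swap_le_of_covBy h (hw.le r) hr
  distinct := hw.distinct.swap ha (ne_bot_of_gt h.lt)
  key i k hik hk hki := by
    have h3 := hw.key i k hik hk hki
    by_cases hka : u k = a
    · rw [Equiv.swap_apply_of_ne_of_ne]
      · exact h3
      · rw [← hka]; exact h3.ne'
      · exact h2 i k hik hka (hka ▸ hki)
    · exact lt_swap_of_covBy h h3 hka

lemma keyStep_swap_iff (h : a ⋖ b) (ha : a ≠ ⊥) (hu : ∀ r, u r ≠ a) :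
    KeyStep p u (fun r => Equiv.swap a b (w r)) ↔ KeyStep p u w := by
  constructor
  · intro hw
    have := hw.swap h ha (fun r hr => absurd hr (hu r)) (fun i k _ hk => absurd hk (hu k))
    simpa using this
  · intro hw
    exact hw.swap h ha (fun r hr => absurd hr (hu r)) (fun i k _ hk => absurd hk (hu k))

/-- If `u` contains `a` but not `b`, changing `a` into `b` keeps the same followers among those
where `a` occurs below `b` or neither occurs. -/
lemma keyStep_swap_left_iff (h : a ⋖ b) (ha : a ≠ ⊥) (hu : ColumnDistinct u)
    (hub : ∀ r, u r ≠ b) (hw : (∀ r, w r ≠ a ∧ w r ≠ b) ∨ OccursBelow a b w) :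
    KeyStep p (fun r => Equiv.swap a b (u r)) w ↔ KeyStep p u w := by
  have hu' : ∀ r, u r ≤ a ∨ b ≤ u r := fun r => (le_or_gt (u r) a).imp_right h.ge_of_gt
  have hw' : ∀ r, w r ≤ a ∨ b ≤ w r := fun r => (le_or_gt (w r) a).imp_right h.ge_of_gt
  have hab := h.lt
  have hσ : ∀ v, Equiv.swap a b v = if v = a then b else if v = b then a else v :=
    Equiv.swap_apply_def a b
  unfold OccursBelow ColumnDistinct at *
  have hb : b ≠ ⊥ := ne_bot_of_gt hab
  constructor
  · rintro ⟨h1, h2, h3, h4⟩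
    have hwb : ∀ r, u r = a → w r ≠ b := by
      intro r hr hwr
      obtain hw | ⟨k, hk, hk'⟩ := hw
      · exact (hw r).2 hwr
      · have h6 := h4 k r (hk' r hwr)
        have h7 := h2 k
        grind
    refine ⟨h1, fun r => ?_, h3, fun i k hik hk hki => ?_⟩
    · have := h2 r
      grind
    · have h5 := h4 i k hik
      grind
  · rintro ⟨h1, h2, h3, h4⟩
    have hwb : ∀ i k, i < k → u k = a → w i ≠ b := by
      intro i r hir hr hwr
      obtain hw | ⟨k, hk, hk'⟩ := hw
      · exact (hw i).2 hwr
      · have h6 := h4 k r ((hk' i hwr).trans hir)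
        have h7 := h2 k
        have := hk' i hwr
        have := hu r k
        grind
    refine ⟨h1, fun r => ?_, h3, fun i k hik hk hki => ?_⟩
    · have := h2 r
      grind
    · have h5 := h4 i k hik
      have := hwb i k hik
      have := hu k i hik.ne'
      grind

/-- If `u` contains `a` below `b`, no column where `a` occurs below `b` or neither occurs follows
the column obtained by exchanging `a` and `b` in `u`. -/
lemma not_keyStep_swap_left (h : a ⋖ b) (ha : a ≠ ⊥)
    (hua : OccursBelow a b u) (hub : ∃ r, u r = b)
    (hw : (∀ r, w r ≠ a ∧ w r ≠ b) ∨ OccursBelow a b w) :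
    ¬ KeyStep p (fun r => Equiv.swap a b (u r)) w := by
  have hu' : ∀ r, u r ≤ a ∨ b ≤ u r := fun r => (le_or_gt (u r) a).imp_right h.ge_of_gt
  have hw' : ∀ r, w r ≤ a ∨ b ≤ w r := fun r => (le_or_gt (w r) a).imp_right h.ge_of_gt
  have hab := h.lt
  have hσ : ∀ v, Equiv.swap a b v = if v = a then b else if v = b then a else v :=
    Equiv.swap_apply_def a b
  rintro ⟨h1, h2, h3, h4⟩
  obtain ⟨r, hr, hrb⟩ := hua
  obtain ⟨s, hs⟩ := hub
  have hrs := hrb s hs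
  have hwr : w r = b := by
    have := h4 r s hrs
    have := h2 r
    grind
  obtain hw | ⟨k, hk, hk'⟩ := hw
  · exact (hw r).2 hwr
  · have := hk' r hwr
    have := h4 k r this
    have := h2 k
    have := hrb k
    have := lt_asymm hrs
    grind

lemma keyStep_swap_or_iff (h : a ⋖ b) (ha : a ≠ ⊥) (hu : ColumnDistinct u)
    (hua : OccursBelow a b u) (hub : ∃ r, u r = b) (hw : OccursBelow a b w) :
    (KeyStep p u (fun r => Equiv.swap a b (w r)) ∨
      KeyStep p (fun r => Equiv.swap a b (u r)) (fun r => Equiv.swap a b (w r))) ↔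
      KeyStep p u w := by
  have hu' : ∀ r, u r ≤ a ∨ b ≤ u r := fun r => (le_or_gt (u r) a).imp_right h.ge_of_gt
  have hw' : ∀ r, w r ≤ a ∨ b ≤ w r := fun r => (le_or_gt (w r) a).imp_right h.ge_of_gt
  have hab := h.lt
  have hb : b ≠ ⊥ := ne_bot_of_gt hab
  have hσ : ∀ v, Equiv.swap a b v = if v = a then b else if v = b then a else v :=
    Equiv.swap_apply_def a b
  obtain ⟨r, hr, hrb⟩ := hua
  obtain ⟨s, hs⟩ := hub
  have hrs := hrb s hs
  have hur : ∀ k, u k = a → k = r := fun k hk => by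
    by_contra hne; exact hu k r hne (hk ▸ ha) (hk.trans hr.symm)
  have hus : ∀ k, u k = b → k = s := fun k hk => by
    by_contra hne; exact hu k s hne (hk ▸ hb) (hk.trans hs.symm)
  have key : ∀ {v : ι → V}, KeyStep p u v → ∀ i k, i < k → u k = a → a < u i → v i ≠ b := by
    rintro v ⟨-, -, -, h4⟩ i k hik hk hki
    have := h4 i s
    grind
  constructor
  · rintro (h' | ⟨h1, h2, h3, h4⟩)
    · have := h'.swap h ha ?_ (key h')
      · simpa using this
      · intro k hk hk'
        obtain ⟨t, ht, hbt⟩ := hw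
        have hwk : w k = b := by grind
        have h6 := hbt k hwk
        have h7 := h'.key t k h6
        have h8 := h'.le t
        grind
    · have hwr := h4 r s hrs
      have hwr' := h2 r
      have hwra : w r = a := by grind
      have hd : ColumnDistinct w := by
        have := ColumnDistinct.swap ha hb h3
        simpa using this
      refine ⟨fun t => ?_, fun t => ?_, hd, fun i k hik hk hki => ?_⟩
      · rw [← h1 t, Ne, Ne, swap_eq_bot_iff ha hb]
      · have := h2 t
        have := hd r t
        grind
      · have := h4 i k hik
        have := hd r i
        grind
  · intro h'
    by_cases hwr : w r = a
    · right
      have hd := h'.distinct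
      have h3 := h'.distinct.swap ha hb
      obtain ⟨h1, h2, -, h4⟩ := h'
      refine ⟨fun t => ?_, fun t => ?_, h3, fun i k hik hk hki => ?_⟩
      · rw [← h1 t, Ne, Ne, swap_eq_bot_iff ha hb]
      · have := h2 t
        have := hd r t
        grind
      · have := h4 i k hik
        have := hd r i
        have := h4 i s
        grind
    · left
      exact h'.swap h ha (fun k hk => (hur k hk).symm ▸ hwr) (key h')

lemma not_keyStep_and_swap (h : a ⋖ b) (ha : a ≠ ⊥) (hua : OccursBelow a b u) (hub : ∃ r, u r = b) :
    ¬ (KeyStep p u w ∧ KeyStep p (fun r => Equiv.swap a b (u r)) w) := by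
  rintro ⟨h1, h2⟩
  obtain ⟨r, hr, hrb⟩ := hua
  obtain ⟨s, hs⟩ := hub
  have h3 := h2.key r s (hrb s hs)
  simp only [hr, hs, Equiv.swap_apply_left, Equiv.swap_apply_right] at h3
  exact absurd (h3 ha h.lt) (hr ▸ h1.le r).not_gt

end KeyChains

section ChainSum

variable {ι V R : Type*} [Fintype ι] [LinearOrder ι] [Fintype V] [LinearOrder V] [OrderBot V]
  [CommRing R]

/-- The sum of the weights of the first `n` columns over all sequences of columns which follow the
column `u` in a key tableau whose `c`-th column occupies the rows in `p c` and whose columns are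
empty from the `n`-th on. -/
def chainSum (y : V → R) : ℕ → (ℕ → ι → Prop) → (ι → V) → R
  | 0, _, u => if ∀ r, u r = ⊥ then 1 else 0
  | n + 1, p, u => ∑ w, if KeyStep (p 0) u w then
      (∏ r, y (w r)) * chainSum y n (fun c => p (c + 1)) w else 0

variable [DecidableEq V] {a b : V} {y : V → R} {s : R →+* R}

/-- The relations satisfied by a family `G` of elements indexed by columns, in terms of the
operator `f ↦ y a * f - y b * s f`. -/
structure DemazureRelations (y : V → R) (s : R →+* R) (a b : V) (G : (ι → V) → R) : Prop where
  free : ∀ u, ColumnDistinct u → (∀ r, u r ≠ a ∧ u r ≠ b) →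
    (y a - y b) * G u = y a * G u - y b * s (G u)
  single : ∀ u, ColumnDistinct u → OccursBelow a b u → (∀ r, u r ≠ b) →
    (y a - y b) * G (fun r => Equiv.swap a b (u r)) = y a * G u - y b * s (G u)
  both : ∀ u, ColumnDistinct u → OccursBelow a b u → (∃ r, u r = b) →
    (y a - y b) * (G u + G (fun r => Equiv.swap a b (u r))) = y a * G u - y b * s (G u)

section Weighted

variable {G : (ι → V) → R} {w : ι → V}

lemma weighted_free (hs : ∀ v, s (y v) = y (Equiv.swap a b v)) (hG : DemazureRelations y s a b G)
    (hw : ColumnDistinct w) (h : ∀ r, w r ≠ a ∧ w r ≠ b) :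
    y a * ((∏ r, y (w r)) * G w) - y b * s ((∏ r, y (w r)) * G w) =
      (y a - y b) * ((∏ r, y (w r)) * G w) := by
  have h1 : s (∏ r, y (w r)) = ∏ r, y (w r) := by
    rw [map_prod]
    exact Finset.prod_congr rfl fun r _ => by
      rw [hs, Equiv.swap_apply_of_ne_of_ne (h r).1 (h r).2]
  have := hG.free w hw h
  rw [map_mul, h1]
  linear_combination (-(∏ r, y (w r))) * this

lemma weighted_below (ha : a ≠ ⊥) (hb : b ≠ ⊥)
    (hs : ∀ v, s (y v) = y (Equiv.swap a b v)) (hss : ∀ f, s (s f) = f)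
    (hD : ∀ f, (y a - y b) * f = 0 → f = 0)
    (hG : DemazureRelations y s a b G) (hw : ColumnDistinct w) (h : OccursBelow a b w) :
    (y a * ((∏ r, y (w r)) * G w) - y b * s ((∏ r, y (w r)) * G w) =
      (y a - y b) * ((∏ r, y (w r)) * G w + (∏ r, y (Equiv.swap a b (w r))) *
        G (fun r => Equiv.swap a b (w r)))) ∧
    y a * ((∏ r, y (Equiv.swap a b (w r))) * G (fun r => Equiv.swap a b (w r))) -
      y b * s ((∏ r, y (Equiv.swap a b (w r))) * G (fun r => Equiv.swap a b (w r))) = 0 := by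
  have hsa : s (y a) = y b := by rw [hs, Equiv.swap_apply_left]
  have hsb : s (y b) = y a := by rw [hs, Equiv.swap_apply_right]
  have hsym : ∀ f g, (y a - y b) * g = y a * f - y b * s f → s g = g := by
    intro f g hfg
    have h1 := congrArg s hfg
    simp only [map_sub, map_mul, hsa, hsb, hss] at h1
    refine sub_eq_zero.1 (hD _ ?_)
    linear_combination -h1 - hfg
  set g := G (fun r => Equiv.swap a b (w r)) with hg
  obtain ⟨k, hk, hkb⟩ := id h
  have huniq : ∀ r, r ≠ k → w r ≠ a := fun r hr hra => hw r k hr (hra ▸ ha) (hra.trans hk.symm)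
  by_cases hwb : ∃ l, w l = b
  · obtain ⟨l, hl⟩ := id hwb
    have hrel := hG.both w hw h hwb
    have hm : ∏ r, y (Equiv.swap a b (w r)) = ∏ r, y (w r) := by
      rw [← Equiv.prod_comp (Equiv.swap k l)]
      refine Finset.prod_congr rfl fun r _ => ?_
      congr 1
      by_cases hrk : r = k
      · subst hrk
        rw [Equiv.swap_apply_left, hl, hk, Equiv.swap_apply_right]
      by_cases hrl : r = l
      · subst hrl
        rw [Equiv.swap_apply_right, hl, hk, Equiv.swap_apply_left]
      rw [Equiv.swap_apply_of_ne_of_ne hrk hrl, Equiv.swap_apply_of_ne_of_ne (huniq r hrk)]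
      exact fun hrb => hw r l hrl (hrb ▸ hb) (hrb.trans hl.symm)
    have hsm : s (∏ r, y (w r)) = ∏ r, y (w r) := by
      rw [map_prod]
      exact (Finset.prod_congr rfl fun r _ => hs (w r)).trans hm
    have h2 : s (G w + g) = G w + g := hsym _ _ hrel
    rw [map_add] at h2
    rw [hm, map_mul, map_mul, hsm]
    constructor
    · linear_combination (-(∏ r, y (w r))) * hrel
    · linear_combination (∏ r, y (w r)) * (hrel - y b * h2)
  · push Not at hwb
    have hrel := hG.single w hw h hwb
    have h2 : s g = g := hsym _ _ hrel
    have h3 : ∏ r, y (w r) = y a * ∏ r ∈ Finset.univ.erase k, y (w r) := by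
      rw [← Finset.mul_prod_erase _ _ (Finset.mem_univ k), hk]
    have h4 : ∏ r, y (Equiv.swap a b (w r)) = y b * ∏ r ∈ Finset.univ.erase k, y (w r) := by
      rw [← Finset.mul_prod_erase _ _ (Finset.mem_univ k), hk, Equiv.swap_apply_left]
      congr 1
      refine Finset.prod_congr rfl fun r hr => ?_
      rw [Equiv.swap_apply_of_ne_of_ne (huniq r (Finset.ne_of_mem_erase hr)) (hwb r)]
    have h5 : s (∏ r ∈ Finset.univ.erase k, y (w r)) = ∏ r ∈ Finset.univ.erase k, y (w r) := by
      rw [map_prod]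
      refine Finset.prod_congr rfl fun r hr => ?_
      rw [hs, Equiv.swap_apply_of_ne_of_ne (huniq r (Finset.ne_of_mem_erase hr)) (hwb r)]
    rw [h3, h4]
    simp only [map_mul, h5, hsa, hsb, h2]
    constructor
    · linear_combination (-y b * ∏ r ∈ Finset.univ.erase k, y (w r)) * hrel
    · ring

end Weighted

/-- Applying `f ↦ y a * f - y b * s f` to a sum over the columns satisfying `P`. -/
lemma sum_demazure (hab : a ≠ b) (ha : a ≠ ⊥) (hb : b ≠ ⊥)
    (hs : ∀ v, s (y v) = y (Equiv.swap a b v)) (hss : ∀ f, s (s f) = f)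
    (hD : ∀ f, (y a - y b) * f = 0 → f = 0) {G : (ι → V) → R}
    (hG : DemazureRelations y s a b G) (P Q : (ι → V) → Prop)
    (hP : ∀ w, P w → ColumnDistinct w) (hQ : ∀ w, Q w → ColumnDistinct w)
    (hfree : ∀ w, (∀ r, w r ≠ a ∧ w r ≠ b) → (Q w ↔ P w))
    (hbelow : ∀ w, OccursBelow a b w → (Q w ↔ P w))
    (habove : ∀ w, OccursBelow a b w → (Q (fun r => Equiv.swap a b (w r)) ↔ P w)) :
    (y a - y b) * (∑ w, if Q w then (∏ r, y (w r)) * G w else 0) =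
      y a * (∑ w, if P w then (∏ r, y (w r)) * G w else 0) -
        y b * s (∑ w, if P w then (∏ r, y (w r)) * G w else 0) := by
  set M : (ι → V) → R := fun w => (∏ r, y (w r)) * G w with hM
  have hsum : y a * (∑ w, if P w then M w else 0) - y b * s (∑ w, if P w then M w else 0) =
      ∑ w, if P w then y a * M w - y b * s (M w) else 0 := by
    rw [map_sum, Finset.mul_sum, Finset.mul_sum, ← Finset.sum_sub_distrib]
    refine Finset.sum_congr rfl fun w _ => ?_
    split_ifs <;> simp
  rw [hsum]
  let e : (ι → V) ≃ (ι → V) := (Equiv.refl ι).arrowCongr (Equiv.swap a b)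
  have he : ∀ w, e w = fun r => Equiv.swap a b (w r) := fun w => rfl
  have hsplit : (∑ w, if Q w then M w else 0) =
      ∑ w, ((if P w ∧ ¬ OccursBelow b a w then M w else 0) +
        (if P w ∧ OccursBelow a b w then M (e w) else 0)) := by
    have h1 : (∑ w, if P w ∧ OccursBelow a b w then M (e w) else 0) =
        ∑ w, if Q w ∧ OccursBelow b a w then M w else 0 := by
      rw [← Equiv.sum_comp e (fun w => if Q w ∧ OccursBelow b a w then M w else 0)]
      refine Finset.sum_congr rfl fun w _ => ?_
      have h2 : OccursBelow b a (e w) ↔ OccursBelow a b w := by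
        rw [he, Equiv.swap_comm, occursBelow_swap]
      have h3 : Q (e w) ∧ OccursBelow b a (e w) ↔ P w ∧ OccursBelow a b w := by
        rw [h2]
        exact and_congr_left fun h => habove w h
      simp only [h3]
    rw [Finset.sum_add_distrib, h1, ← Finset.sum_add_distrib]
    refine Finset.sum_congr rfl fun w _ => ?_
    by_cases hf : ∀ r, w r ≠ a ∧ w r ≠ b
    · have h4 : ¬ OccursBelow b a w := fun ⟨r, hr, _⟩ => (hf r).2 hr
      simp [h4, hfree w hf]
    · by_cases hd : ColumnDistinct w
      · rcases occursBelow_or ha hab hd hf with h5 | h5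
        · have h4 : ¬ OccursBelow b a w := not_occursBelow_symm h5
          simp [h4, hbelow w h5]
        · simp [h5]
      · have h6 : ¬ P w := fun h => hd (hP w h)
        have h7 : ¬ Q w := fun h => hd (hQ w h)
        simp [h6, h7]
  rw [hsplit, Finset.mul_sum]
  refine Finset.sum_congr rfl fun w _ => ?_
  by_cases hPw : P w
  swap
  · simp [hPw]
  have hd := hP w hPw
  by_cases hf : ∀ r, w r ≠ a ∧ w r ≠ b
  · have h4 : ¬ OccursBelow b a w := fun ⟨r, hr, _⟩ => (hf r).2 hr
    have h5 : ¬ OccursBelow a b w := fun ⟨r, hr, _⟩ => (hf r).1 hr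
    simp only [hPw, h4, h5, hM, not_false_eq_true, and_true, and_false, if_true, if_false, add_zero]
    exact (weighted_free hs hG hd hf).symm
  · rcases occursBelow_or ha hab hd hf with h5 | h5
    · have h4 : ¬ OccursBelow b a w := not_occursBelow_symm h5
      simp only [hPw, h4, h5, hM, not_false_eq_true, and_true, if_true]
      exact (weighted_below ha hb hs hss hD hG hd h5).1.symm
    · have h4 : ¬ OccursBelow a b w := not_occursBelow_symm h5
      have h6 : OccursBelow a b (e w) := occursBelow_swap.2 h5
      have h7 := (weighted_below ha hb hs hss hD hG (hd.swap ha hb) h6).2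
      simp only [Equiv.swap_apply_self] at h7
      simp only [hPw, h4, h5, hM, not_true_eq_false, and_false, if_true, if_false, add_zero,
        mul_zero]
      exact h7.symm

/-- The sums over sequences of columns satisfy the Demazure relations. -/
theorem chainSum_demazureRelations (h : a ⋖ b) (ha : a ≠ ⊥)
    (hs : ∀ v, s (y v) = y (Equiv.swap a b v)) (hss : ∀ f, s (s f) = f)
    (hD : ∀ f, (y a - y b) * f = 0 → f = 0) (n : ℕ) (p : ℕ → ι → Prop) :
    DemazureRelations y s a b (chainSum y n p) := by
  have hb : b ≠ ⊥ := ne_bot_of_gt h.lt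
  induction n generalizing p with
  | zero =>
    refine ⟨fun u _ _ => ?_, fun u _ ⟨r, hr, _⟩ _ => ?_, fun u _ ⟨r, hr, _⟩ _ => ?_⟩
    · simp only [chainSum]
      split_ifs <;> simp
    · have h1 : ¬ ∀ r, u r = ⊥ := fun h' => ha (hr ▸ h' r)
      simp [chainSum, swap_eq_bot_iff ha hb, h1]
    · have h1 : ¬ ∀ r, u r = ⊥ := fun h' => ha (hr ▸ h' r)
      simp [chainSum, swap_eq_bot_iff ha hb, h1]
  | succ n ih =>
    have hG := ih (fun c => p (c + 1))
    refine ⟨fun u hu hf => ?_, fun u hu hl hub => ?_, fun u hu hl hub => ?_⟩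
    · simp only [chainSum]
      refine sum_demazure h.lt.ne ha hb hs hss hD hG _ _ (fun w hw => hw.distinct)
        (fun w hw => hw.distinct) (fun _ _ => Iff.rfl) (fun _ _ => Iff.rfl)
        fun w _ => keyStep_swap_iff h ha fun r => (hf r).1
    · simp only [chainSum]
      refine sum_demazure h.lt.ne ha hb hs hss hD hG _ _ (fun w hw => hw.distinct)
        (fun w hw => hw.distinct) (fun w hw => keyStep_swap_left_iff h ha hu hub (Or.inl hw))
        (fun w hw => keyStep_swap_left_iff h ha hu hub (Or.inr hw)) fun w hw => ?_
      rw [keyStep_swap_iff h ha, keyStep_swap_left_iff h ha hu hub (Or.inr hw)]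
      intro r hr
      rw [Equiv.swap_apply_eq_iff, Equiv.swap_apply_left] at hr
      exact hub r hr
    · have hor := sum_demazure h.lt.ne ha hb hs hss hD hG (KeyStep (p 0) u)
        (fun w => KeyStep (p 0) u w ∨ KeyStep (p 0) (fun r => Equiv.swap a b (u r)) w)
        (fun w hw => hw.distinct) (fun w hw => hw.elim (·.distinct) (·.distinct))
        (fun w hw => or_iff_left (not_keyStep_swap_left h ha hl hub (Or.inl hw)))
        (fun w hw => or_iff_left (not_keyStep_swap_left h ha hl hub (Or.inr hw)))
        (fun w hw => keyStep_swap_or_iff h ha hu hl hub hw)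
      simp only [chainSum]
      rw [← hor, ← Finset.sum_add_distrib]
      congr 1
      refine Finset.sum_congr rfl fun w _ => ?_
      have := not_keyStep_and_swap (p := p 0) (w := w) h ha hl hub
      by_cases h1 : KeyStep (p 0) u w
      · have h2 : ¬ KeyStep (p 0) (fun r => Equiv.swap a b (u r)) w := fun h' => this ⟨h1, h'⟩
        simp [h1, h2]
      · simp [h1]

end ChainSum

section Tableaux

/-- The conditions on the entries of a filling `T` whose boxes are those of `α`. -/
structure KeyFilling (α φ : ℕ → ℕ) (T : Tableau) : Prop where
  box : ∀ r c, T r c ≠ 0 ↔ 1 ≤ r ∧ 1 ≤ c ∧ c ≤ α r.toNat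
  row : ∀ r c, 1 ≤ c → T r (c + 1) ≤ T r c
  col : ∀ r r' c, r ≠ r' → T r c ≠ 0 → T r c ≠ T r' c
  key : ∀ r r' c, r < r' → T r' c ≠ 0 → T r' c < T r c → T r' c < T r (c + 1)
  flag : ∀ r c, T r c ≤ φ r.toNat

variable {α φ : ℕ → ℕ}

lemma WeakComp.exists_bound (hα : WeakComp α) :
    ∃ N, (∀ i, N < i → α i = 0) ∧ ∀ i, α i ≤ N := by
  obtain ⟨M, hM⟩ := hα.2.bddAbove
  obtain ⟨K, hK⟩ := (hα.2.image α).bddAbove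
  refine ⟨max M K, fun i hi => ?_, fun i => ?_⟩
  · by_contra h
    have := hM h
    omega
  · by_cases h : α i = 0
    · omega
    · have := hK ⟨i, h, rfl⟩
      omega

lemma mem_SSKT_iff (hα : WeakComp α) {T : Tableau} : T ∈ SSKT α φ ↔ KeyFilling α φ T := by
  constructor
  · rintro ⟨⟨h1, h2, h3, h4, h5, h6, h7⟩, h8, h9⟩
    refine ⟨fun r c => ?_, fun r c hc => ?_, fun r r' c hr h => ?_, fun r r' c hr h h' => ?_,
      fun r c => ?_⟩
    · by_cases hr : r ≤ 0
      · simp [h1 r c hr]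
        omega
      lift r to ℕ using by omega
      have hs : Set.ncard {c : ℕ | T r c ≠ 0} = α r := congrFun h8 r
      have hfin : {c : ℕ | T r c ≠ 0}.Finite :=
        (h3.preimage (f := fun c : ℕ => ((r : ℤ), c)) (fun _ _ _ _ h => by simpa using h))
      have hdown : ∀ k c, 1 ≤ c → T r (c + k) ≠ 0 → T r c ≠ 0 := by
        intro k
        induction k with
        | zero => exact fun c _ h => h
        | succ k ih => exact fun c hc h => ih c hc (h4 _ _ (by omega) h)
      have hsub : {c : ℕ | T r c ≠ 0} ⊆ Set.Icc 1 (α r) := by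
        intro c hc
        have hc0 : 1 ≤ c := by
          by_contra h0
          obtain rfl : c = 0 := by omega
          exact hc (h2 r)
        refine ⟨hc0, ?_⟩
        rw [← hs]
        calc c = (Set.Icc 1 c).ncard := by simp [← Nat.card_coe_set_eq]
          _ ≤ _ := Set.ncard_le_ncard (fun d hd => hdown (c - d) d hd.1 (by
            rwa [Nat.add_sub_cancel' hd.2])) hfin
      have heq := Set.eq_of_subset_of_ncard_le hsub
        (by rw [hs]; simp [← Nat.card_coe_set_eq]) (Set.finite_Icc _ _)
      have := Set.ext_iff.1 heq c
      simp only [Set.mem_ofPred_eq, Set.mem_Icc] at this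
      rw [this]
      simp
      omega
    · by_cases h : T r (c + 1) = 0
      · omega
      · exact h5 r c hc h
    · by_cases h0 : T r' c = 0
      · rwa [h0]
      · exact h6 r r' c hr h h0
    · exact (h7 r r' c hr (by omega) h h').2
    · by_cases hr : r ≤ 0
      · simp [h1 r c hr]
      · lift r to ℕ using by omega
        exact h9 r c
  · rintro ⟨h1, h2, h3, h4, h5⟩
    obtain ⟨N, hN, hN'⟩ := hα.exists_bound
    refine ⟨⟨fun r c hr => ?_, fun r => ?_, ?_, fun r c hc => ?_, fun r c hc _ => h2 r c hc,
      fun r r' c h h' _ => h3 r r' c h h', fun r r' c h _ h' h'' => ?_⟩, ?_, fun r c => ?_⟩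
    · have := h1 r c
      by_contra h
      have := this.1 h
      omega
    · have := h1 r 0
      by_contra h
      have := this.1 h
      omega
    · refine ((Set.finite_Icc (1 : ℤ) N).prod (Set.finite_Icc 1 N)).subset ?_
      rintro ⟨r, c⟩ h
      obtain ⟨hr, hc, hc'⟩ := (h1 r c).1 h
      have := hN' r.toNat
      have h6 : r.toNat ≤ N := by
        by_contra h7
        have := hN r.toNat (by omega)
        omega
      simp only [Set.mem_prod, Set.mem_Icc]
      omega
    · rw [h1, h1]
      omega
    · have := h4 r r' c h h' h''
      exact ⟨by omega, this⟩
    · funext i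
      have : {c : ℕ | T i c ≠ 0} = Set.Icc 1 (α i) := by
        ext c
        simp only [Set.mem_ofPred_eq, h1, Set.mem_Icc, Int.toNat_natCast]
        refine ⟨fun h => h.2, fun h => ⟨?_, h⟩⟩
        have := hα.1
        rcases i.eq_zero_or_pos with rfl | h0 <;> omega
      rw [shapeOf, this]
      simp [← Nat.card_coe_set_eq]
    · have := h5 r c
      simpa using this

end Tableaux

section RowSwap

variable {α φ : ℕ → ℕ} {i : ℕ} {T : Tableau}

lemma KeyFilling.eq_zero_of_nonpos (hT : KeyFilling α φ T) {r : ℤ} (c : ℕ) (hr : r ≤ 0) :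
    T r c = 0 := by
  by_contra h
  have := (hT.box r c).1 h
  omega

lemma KeyFilling.eq_zero_col (hT : KeyFilling α φ T) (r : ℤ) : T r 0 = 0 := by
  by_contra h
  have := (hT.box r 0).1 h
  omega

lemma wtTab_comp (e : ℤ × ℕ ≃ ℤ × ℕ) {T T' : Tableau} (h : ∀ p, T' p.1 p.2 = T (e p).1 (e p).2) :
    wtTab T' = wtTab T := by
  funext v
  unfold wtTab
  split_ifs
  · rfl
  have : {p : ℤ × ℕ | T' p.1 p.2 = v} = e ⁻¹' {p : ℤ × ℕ | T p.1 p.2 = v} := by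
    ext p
    simp [h]
  rw [this, ← Set.ncard_image_of_injective _ e.injective, Set.image_preimage_eq _ e.surjective]

/-- Columns `c` and `c + 1` remain weakly decreasing when the rows `p` and `q` are exchanged in
only one of them. -/
def RowsSeparated (T : Tableau) (p q : ℤ) (c : ℕ) : Prop :=
  T p c ≠ 0 ∧ T q c ≠ 0 ∧ T p (c + 1) ≤ T q c ∧ T q (c + 1) ≤ T p c

/-- Exchange the rows `p` and `q` to the right of the last column separating them. -/
def swapRows (p q : ℤ) (T : Tableau) : Tableau := fun r c =>
  if ∀ d, c ≤ d → ¬ RowsSeparated T p q d then T (Equiv.swap p q r) c else T r c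

lemma RowsSeparated.pos (hT : KeyFilling α φ T) {p q : ℤ} {c : ℕ} (h : RowsSeparated T p q c) :
    1 ≤ c := by
  by_contra h0
  obtain rfl : c = 0 := by omega
  exact h.1 (hT.eq_zero_col p)

lemma forall_not_rowsSeparated_iff {p q : ℤ} {c : ℕ} :
    (∀ d, c ≤ d → ¬ RowsSeparated T p q d) ↔
      ¬ RowsSeparated T p q c ∧ ∀ d, c + 1 ≤ d → ¬ RowsSeparated T p q d := by
  refine ⟨fun h => ⟨h c le_rfl, fun d hd => h d (by omega)⟩, fun h d hd => ?_⟩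
  obtain rfl | hd := hd.eq_or_lt
  · exact h.1
  · exact h.2 d hd

lemma rowsSeparated_swapRows (hT : KeyFilling α φ T) {p q : ℤ} (c : ℕ) :
    RowsSeparated (swapRows p q T) p q c ↔ RowsSeparated T p q c := by
  have h1 := forall_not_rowsSeparated_iff (T := T) (p := p) (q := q) (c := c)
  unfold RowsSeparated swapRows
  by_cases h2 : ∀ d, c + 1 ≤ d → ¬ RowsSeparated T p q d
  · by_cases h3 : RowsSeparated T p q c
    · have h4 := hT.row p c (h3.pos hT)
      have h5 := hT.row q c (h3.pos hT)
      have h6 : ¬ ∀ d, c ≤ d → ¬ RowsSeparated T p q d := fun h => (h1.1 h).1 h3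
      rw [if_neg h6, if_neg h6, if_pos h2, if_pos h2, Equiv.swap_apply_left,
        Equiv.swap_apply_right]
      unfold RowsSeparated at h3
      tauto
    · rw [if_pos (h1.2 ⟨h3, h2⟩), if_pos (h1.2 ⟨h3, h2⟩), if_pos h2, if_pos h2,
        Equiv.swap_apply_left, Equiv.swap_apply_right]
      tauto
  · have h6 : ¬ ∀ d, c ≤ d → ¬ RowsSeparated T p q d := fun h => h2 (h1.1 h).2
    rw [if_neg h6, if_neg h6, if_neg h2, if_neg h2]

lemma swapRows_swapRows (hT : KeyFilling α φ T) (p q : ℤ) : swapRows p q (swapRows p q T) = T := by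
  funext r c
  rw [swapRows]
  simp only [rowsSeparated_swapRows hT]
  simp only [swapRows]
  split_ifs <;> simp

lemma wtTab_swapRows (p q : ℤ) : wtTab (swapRows p q T) = wtTab T := by
  have hinv : Function.Involutive fun x : ℤ × ℕ =>
      if ∀ d, x.2 ≤ d → ¬ RowsSeparated T p q d then (Equiv.swap p q x.1, x.2) else x := by
    intro x
    by_cases h : ∀ d, x.2 ≤ d → ¬ RowsSeparated T p q d
    · simp only [if_pos h, Equiv.swap_apply_self]
    · simp only [if_neg h]
  refine wtTab_comp hinv.toPerm fun x => ?_
  simp only [Function.Involutive.coe_toPerm, swapRows]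
  split_ifs <;> rfl

lemma toNat_swap (hi : 1 ≤ i) (r : ℤ) :
    (Equiv.swap (i : ℤ) (i + 1) r).toNat = sPerm i r.toNat := by
  unfold sPerm
  rw [Equiv.swap_apply_def, Equiv.swap_apply_def]
  split_ifs <;> omega

lemma KeyFilling.swapRows (hi : 1 ≤ i) (hφ : φ i = φ (i + 1)) (hT : KeyFilling α φ T) :
    KeyFilling (swapC α i) φ (swapRows i (i + 1) T) := by
  have hlast := fun c => forall_not_rowsSeparated_iff (T := T) (p := i) (q := i + 1) (c := c)
  have hbox : ∀ r c, (∃ d, c ≤ d ∧ RowsSeparated T i (i + 1) d) →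
      (T (Equiv.swap (i : ℤ) (i + 1) r) c ≠ 0 ↔ T r c ≠ 0) := by
    rintro r c ⟨d, hd, h1, h2, -, -⟩
    rw [hT.box] at h1 h2
    rw [Equiv.swap_apply_def]
    split_ifs with h3 h4
    · subst h3
      rw [hT.box, hT.box]
      omega
    · subst h4
      rw [hT.box, hT.box]
      omega
    · rfl
  have hsw : ∀ r c, T (Equiv.swap (i : ℤ) (i + 1) r) c ≠ 0 ↔
      1 ≤ r ∧ 1 ≤ c ∧ c ≤ swapC α i r.toNat := by
    intro r c
    rw [hT.box, toNat_swap hi, swapC]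
    have : 1 ≤ Equiv.swap (i : ℤ) (i + 1) r ↔ 1 ≤ r := by
      rw [Equiv.swap_apply_def]
      split_ifs <;> omega
    rw [this]
  refine ⟨fun r c => ?_, fun r c hc => ?_, fun r r' c hr => ?_, fun r r' c hr => ?_,
    fun r c => ?_⟩
  · rw [← hsw, _root_.swapRows]
    split_ifs with h
    · rfl
    · push Not at h
      exact (hbox r c h).symm
  · have h1 := hT.row r c hc
    have h2 := hT.row (Equiv.swap (i : ℤ) (i + 1) r) c hc
    unfold _root_.swapRows
    by_cases h4 : ∀ d, c + 1 ≤ d → ¬ RowsSeparated T i (i + 1) d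
    · by_cases h3 : RowsSeparated T i (i + 1) c
      · rw [if_neg (fun h => ((hlast c).1 h).1 h3), if_pos h4]
        obtain ⟨-, -, h5, h6⟩ := h3
        rw [Equiv.swap_apply_def]
        split_ifs with h7 h8
        · rwa [h7]
        · rwa [h8]
        · exact h1
      · rwa [if_pos ((hlast c).2 ⟨h3, h4⟩), if_pos h4]
    · rwa [if_neg (fun h => h4 ((hlast c).1 h).2), if_neg h4]
  · unfold _root_.swapRows
    split_ifs
    · exact hT.col _ _ c ((Equiv.swap _ _).injective.ne hr)
    · exact hT.col r r' c hr
  · unfold _root_.swapRows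
    by_cases h4 : ∀ d, c + 1 ≤ d → ¬ RowsSeparated T i (i + 1) d
    · by_cases h3 : RowsSeparated T i (i + 1) c
      · have hc := h3.pos hT
        rw [if_neg (fun h => ((hlast c).1 h).1 h3), if_neg (fun h => ((hlast c).1 h).1 h3),
          if_pos h4]
        obtain ⟨-, -, h5, h6⟩ := h3
        intro h7 h8
        have h9 := hT.key r r' c hr h7 h8
        rw [Equiv.swap_apply_def]
        split_ifs with h10 h10
        · subst h10
          by_cases h11 : r' = i + 1
          · subst h11
            omega
          · exact hT.key _ r' c (by omega) h7 (by omega)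
        · subst h10
          exact hT.key _ r' c (by omega) h7 (by omega)
        · exact h9
      · rw [if_pos ((hlast c).2 ⟨h3, h4⟩), if_pos ((hlast c).2 ⟨h3, h4⟩), if_pos h4]
        intro h7 h8
        by_cases h9 : r = i ∧ r' = i + 1
        · obtain ⟨rfl, rfl⟩ := h9
          rw [Equiv.swap_apply_left, Equiv.swap_apply_right] at *
          have hc := ((hT.box _ _).1 h7).2.1
          by_contra h10
          have := hT.row i c hc
          exact h3 ⟨h7, by omega, by omega, by omega⟩
        · refine hT.key _ _ c ?_ h7 h8
          rw [Equiv.swap_apply_def, Equiv.swap_apply_def]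
          split_ifs <;> omega
    · rw [if_neg (fun h => h4 ((hlast c).1 h).2), if_neg (fun h => h4 ((hlast c).1 h).2),
        if_neg h4]
      exact hT.key r r' c hr
  · unfold _root_.swapRows
    have h1 := hT.flag r c
    have h2 := hT.flag (Equiv.swap (i : ℤ) (i + 1) r) c
    rw [toNat_swap hi] at h2
    have h3 : φ (sPerm i r.toNat) = φ r.toNat := by
      rw [sPerm, Equiv.swap_apply_def]
      split_ifs with h4 h4
      · rw [h4, hφ]
      · rw [h4, hφ]
      · rfl
    split_ifs
    · rwa [← h3]
    · exact h1

lemma WeakComp.swapC (hα : WeakComp α) (hi : 1 ≤ i) : WeakComp (swapC α i) := by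
  refine ⟨?_, ?_⟩
  · rw [_root_.swapC, sPerm, Equiv.swap_apply_of_ne_of_ne (by omega) (by omega), hα.1]
  · exact hα.2.preimage (f := sPerm i) (sPerm i).injective.injOn

lemma swapC_swapC (α : ℕ → ℕ) (i : ℕ) : swapC (swapC α i) i = α := by
  funext j
  simp [swapC, sPerm]

/-- If the flag agrees on two consecutive rows, these rows may be exchanged. -/
lemma flaggedKeyPoly_swapC (hα : WeakComp α) (hi : 1 ≤ i) (hφ : φ i = φ (i + 1)) :
    flaggedKeyPoly α φ = flaggedKeyPoly (swapC α i) φ := by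
  have hmaps : ∀ {β : ℕ → ℕ}, WeakComp β →
      Set.MapsTo (swapRows i (i + 1)) (SSKT β φ) (SSKT (swapC β i) φ) := fun hβ T hT =>
    (mem_SSKT_iff (hβ.swapC hi)).2 (((mem_SSKT_iff hβ).1 hT).swapRows hi hφ)
  refine finsum_mem_eq_of_bijOn (swapRows i (i + 1)) ?_ fun T _ => by rw [wtTab_swapRows]
  refine Set.InvOn.bijOn (f' := swapRows i (i + 1))
    ⟨fun T hT => swapRows_swapRows ((mem_SSKT_iff hα).1 hT) _ _,
      fun T hT => swapRows_swapRows ((mem_SSKT_iff (hα.swapC hi)).1 hT) _ _⟩ (hmaps hα) ?_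
  have := hmaps (hα.swapC hi)
  rwa [swapC_swapC] at this

/-- If the flag agrees on rows `i` and `i + 1` and the first one is not longer, then the flag can be
lowered on the first one. -/
lemma flaggedKeyPoly_subE (hα : WeakComp α) (hi : 1 ≤ i) (hφi : 1 ≤ φ i) (hφ : φ i = φ (i + 1))
    (h : α i ≤ α (i + 1)) : flaggedKeyPoly α φ = flaggedKeyPoly α (subE φ i) := by
  suffices SSKT α φ = SSKT α (subE φ i) by rw [flaggedKeyPoly, flaggedKeyPoly, this]
  ext T
  rw [mem_SSKT_iff hα, mem_SSKT_iff hα]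
  refine ⟨fun hT => ⟨hT.box, hT.row, hT.col, hT.key, fun r c => ?_⟩,
    fun hT => ⟨hT.box, hT.row, hT.col, hT.key, fun r c => (hT.flag r c).trans ?_⟩⟩
  swap
  · rw [subE]
    split_ifs <;> omega
  have h1 := hT.flag r c
  rw [subE]
  split_ifs with hri
  swap
  · exact h1
  obtain rfl : r = i := by omega
  by_contra h2
  have h3 : T i c = φ i := by
    rw [Int.toNat_natCast] at *
    omega
  obtain ⟨-, h4, h5⟩ := (hT.box i c).1 (by omega)
  rw [Int.toNat_natCast] at h5
  have h6 : T i c ≤ T i 1 := by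
    have hanti : ∀ k, T i (1 + k) ≤ T i 1 := by
      intro k
      induction k with
      | zero => rfl
      | succ k ih => exact (hT.row i (1 + k) (by omega)).trans ih
    have := hanti (c - 1)
    rwa [show 1 + (c - 1) = c by omega] at this
  have h7 : ∀ k, k + 1 ≤ α (i + 1) → T (i + 1) (k + 1) < T i (k + 1) := by
    intro k
    induction k with
    | zero =>
      intro _
      have h8 := hT.flag (i + 1) (0 + 1)
      have h9 := hT.col i (i + 1) (0 + 1) (by omega) (by rw [zero_add]; omega)
      rw [show ((i : ℤ) + 1).toNat = i + 1 by omega] at h8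
      simp only [zero_add] at *
      omega
    | succ k ih =>
      intro hk
      have h8 := hT.row (i + 1) (k + 1) (by omega)
      have h9 : T (i + 1) (k + 1) ≠ 0 := by
        rw [hT.box, show ((i : ℤ) + 1).toNat = i + 1 by omega]
        omega
      have := hT.key i (i + 1) (k + 1) (by omega) h9 (ih (by omega))
      omega
  have h8 : T (i + 1) (α (i + 1)) ≠ 0 := by
    rw [hT.box, show ((i : ℤ) + 1).toNat = i + 1 by omega]
    omega
  have h9 := h7 (α (i + 1) - 1) (by omega)
  rw [Nat.sub_add_cancel (by omega)] at h9
  have h10 := hT.key i (i + 1) (α (i + 1)) (by omega) h8 h9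
  have h11 := ((hT.box i _).1 (by omega : T i (α (i + 1) + 1) ≠ 0)).2.2
  rw [Int.toNat_natCast] at h11
  omega

end RowSwap

section StrictFlag

variable {α β φ : ℕ → ℕ} {T : Tableau}

/-- The extension of a function on the positive integers to all integers. -/
def rowMap (φ : ℕ → ℕ) (r : ℤ) : ℤ := if 1 ≤ r then φ r.toNat else r

lemma one_le_rowMap_iff (hφ1 : ∀ i, 1 ≤ i → 1 ≤ φ i) (r : ℤ) : 1 ≤ rowMap φ r ↔ 1 ≤ r := by
  rw [rowMap]
  split_ifs with h
  · have := hφ1 r.toNat (by omega)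
    omega
  · rfl

lemma rowMap_strictMono (hφ1 : ∀ i, 1 ≤ i → 1 ≤ φ i) (hφ : ∀ i, 1 ≤ i → φ i < φ (i + 1)) :
    StrictMono (rowMap φ) := by
  refine strictMono_int_of_lt_succ fun r => ?_
  unfold rowMap
  split_ifs with h1 h2 h2
  · have := hφ r.toNat (by omega)
    rw [show (r + 1).toNat = r.toNat + 1 by omega]
    omega
  · omega
  · have := hφ1 (r + 1).toNat (by omega)
    omega
  · omega

/-- A strictly increasing flag amounts to a renaming of the rows. -/
lemma flaggedKeyPoly_of_strictMono (hα : WeakComp α) (hβ : WeakComp β)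
    (hφ1 : ∀ i, 1 ≤ i → 1 ≤ φ i) (hφ : ∀ i, 1 ≤ i → φ i < φ (i + 1))
    (hβφ : ∀ i, 1 ≤ i → β (φ i) = α i) (hβ0 : ∀ j, β j ≠ 0 → ∃ i, 1 ≤ i ∧ φ i = j) :
    flaggedKeyPoly α φ = flaggedKeyPoly β id := by
  have hmono := rowMap_strictMono hφ1 hφ
  have hinj := hmono.injective
  have hpos := one_le_rowMap_iff hφ1
  have hval : ∀ r : ℤ, 1 ≤ r → β (rowMap φ r).toNat = α r.toNat := by
    intro r hr
    rw [rowMap, if_pos hr, Int.toNat_natCast, hβφ _ (by omega)]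
  have hrange : ∀ r : ℤ, 1 ≤ r → β r.toNat ≠ 0 → ∃ r', rowMap φ r' = r := by
    intro r hr h
    obtain ⟨i, hi, hir⟩ := hβ0 _ h
    refine ⟨i, ?_⟩
    rw [rowMap, if_pos (by omega), Int.toNat_natCast, hir]
    omega
  have hrange' : ∀ {T}, KeyFilling β id T → ∀ r c, (¬ ∃ r', rowMap φ r' = r) → T r c = 0 := by
    intro T hT r c h
    by_contra h0
    obtain ⟨h1, h2, h3⟩ := (hT.box r c).1 h0
    exact h (hrange r h1 (by omega))
  obtain ⟨E, hE, hE0⟩ : ∃ E : Tableau → Tableau, (∀ T r c, E T (rowMap φ r) c = T r c) ∧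
      ∀ T r c, (¬ ∃ r', rowMap φ r' = r) → E T r c = 0 :=
    ⟨fun T => Function.extend (rowMap φ) T fun _ _ => 0,
      fun T r c => congrFun (hinj.extend_apply _ _ _) c,
      fun T r c h => congrFun (Function.extend_apply' _ _ _ h) c⟩
  symm
  refine finsum_mem_eq_of_bijOn (fun T r c => T (rowMap φ r) c) ?_ fun T hT => ?_
  · refine Set.InvOn.bijOn (f' := E)
      ⟨fun T hT => ?_, fun T hT => ?_⟩ (fun T hT => ?_) fun T hT => ?_
    · rw [mem_SSKT_iff hβ] at hT
      funext r c
      by_cases h : ∃ r', rowMap φ r' = r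
      · obtain ⟨r', rfl⟩ := h
        rw [hE]
      · rw [hE0 _ _ _ h, hrange' hT r c h]
    · funext r c
      exact hE _ _ _
    · rw [mem_SSKT_iff hβ] at hT
      refine (mem_SSKT_iff hα).2 ⟨fun r c => ?_, fun r c => hT.row _ c,
        fun r r' c h => hT.col _ _ c (hinj.ne h), fun r r' c h => hT.key _ _ c (hmono h),
        fun r c => ?_⟩
      · rw [hT.box, hpos]
        exact and_congr_right fun hr => by rw [hval r hr]
      · by_cases hr : 1 ≤ r
        · have h1 := hT.flag (rowMap φ r) c
          have h2 : (rowMap φ r).toNat = φ r.toNat := by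
            rw [rowMap, if_pos hr, Int.toNat_natCast]
          rwa [id, h2] at h1
        · simp only [rowMap, if_neg hr]
          rw [hT.eq_zero_of_nonpos c (by omega)]
          exact Nat.zero_le _
    · rw [mem_SSKT_iff hα] at hT
      refine (mem_SSKT_iff hβ).2 ?_
      have h2 : ∀ r c, E T r c ≠ 0 → ∃ r', rowMap φ r' = r := by
        intro r c h
        by_contra h'
        exact h (hE0 T r c h')
      refine ⟨fun r c => ?_, fun r c hc => ?_, fun r r' c hr h h' => ?_,
        fun r r' c hr h h' => ?_, fun r c => ?_⟩
      · by_cases h : ∃ r', rowMap φ r' = r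
        · obtain ⟨r', rfl⟩ := h
          rw [hE, hT.box, hpos]
          refine and_congr_right fun hr => ?_
          rw [hval r' hr]
        · refine ⟨fun h' => absurd (h2 r c h') h, fun h' => absurd (hrange r h'.1 ?_) h⟩
          omega
      · by_cases h0 : E T r (c + 1) = 0
        · omega
        obtain ⟨r', rfl⟩ := h2 r _ h0
        rw [hE, hE]
        exact hT.row r' c hc
      · obtain ⟨s, rfl⟩ := h2 r c h
        obtain ⟨s', rfl⟩ := h2 r' c (by rwa [← h'])
        rw [hE] at h
        rw [hE, hE] at h'
        exact hT.col s s' c (fun h3 => hr (h3 ▸ rfl)) h h'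
      · obtain ⟨s, rfl⟩ := h2 r c (by omega)
        obtain ⟨s', rfl⟩ := h2 r' c h
        rw [hE] at h
        rw [hE, hE] at h'
        rw [hE, hE]
        exact hT.key s s' c (hmono.lt_iff_lt.1 hr) h h'
      · by_cases h0 : E T r c = 0
        · omega
        obtain ⟨s, rfl⟩ := h2 r _ h0
        rw [hE] at h0 ⊢
        have hs := ((hT.box s c).1 h0).1
        rw [rowMap, if_pos hs, Int.toNat_natCast]
        exact hT.flag s c
  · rw [mem_SSKT_iff hβ] at hT
    congr 1
    funext v
    unfold wtTab
    split_ifs with hv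
    · rfl
    have hinj' : Function.Injective fun p : ℤ × ℕ => (rowMap φ p.1, p.2) := by
      rintro ⟨p, c⟩ ⟨p', c'⟩ h
      simp only [Prod.mk.injEq] at h
      rw [hinj h.1, h.2]
    symm
    rw [← Set.ncard_image_of_injective _ hinj']
    congr 1
    ext ⟨r, c⟩
    constructor
    · rintro ⟨⟨r', c'⟩, h, h'⟩
      simp only [Prod.mk.injEq] at h'
      obtain ⟨rfl, rfl⟩ := h'
      exact h
    · intro h
      replace h : T r c = v := h
      by_cases h' : ∃ r', rowMap φ r' = r
      · obtain ⟨r', rfl⟩ := h'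
        exact ⟨(r', c), h, rfl⟩
      · exact absurd (hrange' hT r c h') (by omega)

end StrictFlag

section Matrices

variable {ι V R : Type*} [Fintype ι] [LinearOrder ι] [Fintype V] [LinearOrder V] [OrderBot V]
  [CommRing R]

lemma sum_chainSum_eq_sum_matrix (y : V → R) (n : ℕ) (p : ℕ → ι → Prop) (C : (ι → V) → Prop) :
    (∑ w, if C w then (∏ r, y (w r)) * chainSum y n p w else 0) =
      ∑ M : Fin (n + 1) → ι → V, if C (M 0) ∧
        (∀ c : Fin n, KeyStep (p c) (M c.castSucc) (M c.succ)) ∧ ∀ r, M (Fin.last n) r = ⊥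
        then ∏ c, ∏ r, y (M c r) else 0 := by
  induction n generalizing p C with
  | zero =>
    rw [← Equiv.sum_comp (Equiv.funUnique (Fin 1) (ι → V)).symm]
    refine Finset.sum_congr rfl fun w _ => ?_
    simp [chainSum, ite_and]
  | succ n ih =>
    rw [← Equiv.sum_comp (Fin.consEquiv fun _ : Fin (n + 2) => ι → V), Fintype.sum_prod_type]
    refine Finset.sum_congr rfl fun w _ => ?_
    by_cases hC : C w
    · rw [if_pos hC, chainSum, ih (fun c => p (c + 1)) (KeyStep (p 0) w), Finset.mul_sum]
      refine Finset.sum_congr rfl fun M _ => ?_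
      have h1 : (C ((Fin.consEquiv fun _ : Fin (n + 2) => ι → V) (w, M) 0) ∧
          (∀ c : Fin (n + 1), KeyStep (p c)
            ((Fin.consEquiv fun _ : Fin (n + 2) => ι → V) (w, M) c.castSucc)
            ((Fin.consEquiv fun _ : Fin (n + 2) => ι → V) (w, M) c.succ)) ∧
          ∀ r, (Fin.consEquiv fun _ : Fin (n + 2) => ι → V) (w, M) (Fin.last (n + 1)) r = ⊥) ↔
          KeyStep (p 0) w (M 0) ∧ (∀ c : Fin n, KeyStep (p (c + 1)) (M c.castSucc) (M c.succ)) ∧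
            ∀ r, M (Fin.last n) r = ⊥ := by
        rw [Fin.forall_fin_succ, ← Fin.succ_last]
        simp [Fin.consEquiv, hC, and_assoc]
      simp only [h1]
      rw [Fin.prod_univ_succ (n := n + 1), mul_ite, mul_zero]
      rfl
    · simp [Fin.consEquiv, hC]


variable {α φ : ℕ → ℕ} {m N K : ℕ}

/-- The tableau with the given columns. -/
def matTab (M : Fin m → Fin N → Fin (K + 1)) : Tableau := fun r c =>
  if h : (1 ≤ r ∧ r.toNat ≤ N) ∧ 1 ≤ c ∧ c ≤ m then
    M ⟨c - 1, by omega⟩ ⟨r.toNat - 1, by omega⟩ else 0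

lemma matTab_apply (M : Fin m → Fin N → Fin (K + 1)) (c : Fin m) (r : Fin N) :
    matTab M (r + 1) (c + 1) = M c r := by
  have hr : ((r : ℤ) + 1).toNat = r + 1 := by omega
  rw [matTab, dif_pos (by omega)]
  simp only [hr, Nat.add_sub_cancel]

lemma matTab_cases (M : Fin m → Fin N → Fin (K + 1)) (r : ℤ) (c : ℕ) :
    (∃ (c' : Fin m) (r' : Fin N), r = r' + 1 ∧ c = c' + 1) ∨ matTab M r c = 0 := by
  by_cases h : (1 ≤ r ∧ r.toNat ≤ N) ∧ 1 ≤ c ∧ c ≤ m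
  · refine Or.inl ⟨⟨c - 1, by omega⟩, ⟨r.toNat - 1, by omega⟩, ?_, ?_⟩
    · simp only
      omega
    · simp only
      omega
  · exact Or.inr (dif_neg h)

lemma xExp_eq_prod {β : ℕ → ℕ} (hβ : ∀ i, K < i → β i = 0) :
    xExp β = ∏ v : Fin (K + 1), MvPolynomial.X (v : ℕ) ^ β v := by
  rw [xExp, ← Finset.prod_range (fun i => (MvPolynomial.X i : MvPolynomial ℕ ℤ) ^ β i)]
  have hbdd : BddAbove {n : ℕ | β n ≠ 0} := ⟨K, fun i hi => by
    by_contra h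
    exact hi (hβ i (by omega))⟩
  refine Finset.prod_subset (fun i hi => ?_) fun i _ hi => ?_
  · rw [Finset.mem_range] at *
    have : sSup {n : ℕ | β n ≠ 0} ≤ K := csSup_le' fun i hi => by
      by_contra h
      exact hi (hβ i (by omega))
    omega
  · by_cases h : β i = 0
    · rw [h, pow_zero]
    · exact absurd (le_csSup hbdd h) (by rw [Finset.mem_range] at hi; omega)

/-- The variable attached to an entry, where `0` stands for the absence of a box. -/
def entryVar (K : ℕ) (v : Fin (K + 1)) : MvPolynomial ℕ ℤ :=
  if (v : ℕ) = 0 then 1 else MvPolynomial.X (v : ℕ)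

lemma xExp_wtTab_matTab (M : Fin m → Fin N → Fin (K + 1)) :
    xExp (wtTab (matTab M)) = ∏ c, ∏ r, entryVar K (M c r) := by
  have hwt : ∀ v, v ≠ 0 → wtTab (matTab M) v =
      (Finset.univ.filter fun p : Fin m × Fin N => (M p.1 p.2 : ℕ) = v).card := by
    intro v hv
    have hinj : Function.Injective fun p : Fin m × Fin N => (((p.2 : ℕ) : ℤ) + 1, (p.1 : ℕ) + 1) := by
      rintro ⟨c, r⟩ ⟨c', r'⟩ h
      simp only [Prod.mk.injEq] at h
      ext <;> simp only <;> omega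
    rw [wtTab, if_neg hv, ← Set.ncard_coe_finset, ← Set.ncard_image_of_injective _ hinj]
    congr 1
    ext ⟨r, c⟩
    constructor
    · intro h
      replace h : matTab M r c = v := h
      rcases matTab_cases M r c with ⟨c', r', rfl, rfl⟩ | h0
      · rw [matTab_apply] at h
        exact ⟨(c', r'), by simpa using h, rfl⟩
      · omega
    · rintro ⟨⟨c', r'⟩, h, h'⟩
      simp only [Prod.mk.injEq] at h'
      obtain ⟨rfl, rfl⟩ := h'
      exact (matTab_apply M c' r').trans (by simpa using h)
  rw [xExp_eq_prod (K := K), ← Fintype.prod_prod_type' (f := fun c r => entryVar K (M c r)),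
    ← Finset.prod_fiberwise (Finset.univ) fun p : Fin m × Fin N => M p.1 p.2]
  · refine Finset.prod_congr rfl fun v _ => ?_
    by_cases hv : (v : ℕ) = 0
    · rw [hv, wtTab, if_pos rfl, pow_zero]
      refine (Finset.prod_eq_one fun p hp => ?_).symm
      rw [Finset.mem_filter] at hp
      rw [hp.2, entryVar, if_pos hv]
    · rw [hwt _ hv, Finset.prod_congr rfl (g := fun _ => MvPolynomial.X (v : ℕ)) fun p hp => ?_,
        Finset.prod_const]
      · simp only [Fin.ext_iff]
      · rw [Finset.mem_filter] at hp
        rw [hp.2, entryVar, if_neg hv]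
  · intro v hv
    rw [hwt v (by omega), Finset.card_eq_zero, Finset.filter_eq_empty_iff]
    intro p _
    omega

lemma keyFilling_matTab_iff {n : ℕ} (hN : ∀ i, N < i → α i = 0) (hn : ∀ i, α i ≤ n)
    (M : Fin (n + 1) → Fin N → Fin (K + 1)) :
    KeyFilling α φ (matTab M) ↔
      ((∀ r, M 0 r ≠ ⊥ ↔ 1 ≤ α (r + 1)) ∧ (∀ r, (M 0 r : ℕ) ≤ φ (r + 1)) ∧
        ColumnDistinct (M 0)) ∧
      (∀ c : Fin n, KeyStep (fun r : Fin N => (c : ℕ) + 2 ≤ α (r + 1)) (M c.castSucc) (M c.succ)) ∧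
      ∀ r, M (Fin.last n) r = ⊥ := by
  have hbot : ∀ x : Fin (K + 1), x = ⊥ ↔ (x : ℕ) = 0 := fun x => Fin.ext_iff
  have hrow : ∀ r : Fin N, ((r : ℤ) + 1).toNat = r + 1 := fun r => by omega
  constructor
  · intro hT
    have hbox : ∀ c r, M c r ≠ ⊥ ↔ c + 1 ≤ α (r + 1) := by
      intro c r
      have := hT.box (r + 1) (c + 1)
      rw [matTab_apply, hrow] at this
      rw [Ne, hbot, ← Ne, this]
      omega
    have hcol : ∀ c, ColumnDistinct (M c) := by
      intro c r r' hr h h'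
      refine hT.col (r + 1) (r' + 1) (c + 1) (by omega) ?_ ?_
      · rwa [matTab_apply, Ne, ← hbot]
      · rw [matTab_apply, matTab_apply, h']
    refine ⟨⟨fun r => hbox 0 r, fun r => ?_, hcol 0⟩, fun c => ⟨fun r => ?_, fun r => ?_, hcol _,
      fun i k hik hk hki => ?_⟩, fun r => ?_⟩
    · have := hT.flag (r + 1) ((0 : Fin (n + 1)) + 1)
      rwa [matTab_apply, hrow] at this
    · rw [hbox, Fin.val_succ]
    · have := hT.row (r + 1) (c.castSucc + 1) (by omega)
      rw [matTab_apply, show (c.castSucc : ℕ) + 1 = c.succ by simp, matTab_apply] at this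
      exact this
    · have := hT.key (i + 1) (k + 1) (c.castSucc + 1) (by omega)
        (by rwa [matTab_apply, Ne, ← hbot])
      rw [matTab_apply, matTab_apply, show (c.castSucc : ℕ) + 1 = c.succ by simp,
        matTab_apply] at this
      exact this hki
    · have h1 := hbox (Fin.last n) r
      have h2 := hn (r + 1)
      rw [Fin.val_last] at h1
      by_contra h
      have := h1.1 h
      omega
  · rintro ⟨⟨h1, h2, h3⟩, h4, h5⟩
    have hbox : ∀ c r, (M c r : ℕ) ≠ 0 ↔ c + 1 ≤ α (r + 1) := by
      intro c r
      rw [Ne, ← hbot]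
      induction c using Fin.cases with
      | zero => exact h1 r
      | succ c => rw [← Ne, (h4 c).support, Fin.val_succ]
    have hcol : ∀ c, ColumnDistinct (M c) := by
      intro c
      induction c using Fin.cases with
      | zero => exact h3
      | succ c => exact (h4 c).distinct
    have hflag : ∀ c r, (M c r : ℕ) ≤ φ (r + 1) := by
      intro c r
      induction c using Fin.induction with
      | zero => exact h2 r
      | succ c ih => exact le_trans ((h4 c).le r) ih
    refine ⟨fun r c => ?_, fun r c hc => ?_, fun r r' c hr h h' => ?_, fun r r' c hr h h' => ?_,
      fun r c => ?_⟩
    · by_cases h : ∃ (c' : Fin (n + 1)) (r' : Fin N), r = r' + 1 ∧ c = c' + 1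
      · obtain ⟨c', r', rfl, rfl⟩ := h
        rw [matTab_apply, hbox, hrow]
        omega
      · rw [(matTab_cases M r c).resolve_left h]
        refine ⟨fun h' => absurd rfl h', fun h' => absurd ?_ h⟩
        have h6 := hn r.toNat
        have h7 := hN r.toNat
        exact ⟨⟨c - 1, by omega⟩, ⟨r.toNat - 1, by omega⟩, by simp only; omega,
          by simp only; omega⟩
    · rcases matTab_cases M r (c + 1) with ⟨c', r', rfl, h⟩ | h
      · induction c' using Fin.cases with
        | zero =>
          rw [Fin.val_zero] at h
          omega
        | succ c' =>
          rw [h, matTab_apply, show c = c'.castSucc + 1 by simpa using h, matTab_apply]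
          exact (h4 c').le r'
      · omega
    · obtain ⟨c', s, rfl, rfl⟩ := (matTab_cases M r c).resolve_right h
      obtain ⟨c'', s', rfl, h6⟩ := (matTab_cases M r' _).resolve_right (h' ▸ h)
      obtain rfl : c' = c'' := by omega
      rw [matTab_apply] at h
      rw [matTab_apply, matTab_apply, ← Fin.ext_iff] at h'
      exact hcol c' s s' (fun h7 => hr (h7 ▸ rfl)) (by rwa [Ne, hbot]) h'
    · obtain ⟨c', s, rfl, rfl⟩ := (matTab_cases M r c).resolve_right (by omega)
      obtain ⟨c'', s', rfl, h6⟩ := (matTab_cases M r' _).resolve_right h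
      obtain rfl : c' = c'' := by omega
      rw [matTab_apply] at h
      rw [matTab_apply, matTab_apply] at h'
      induction c' using Fin.lastCases with
      | last => exact absurd ((hbot _).1 (h5 s')) h
      | cast c' =>
        rw [matTab_apply, show (c'.castSucc : ℕ) + 1 = c'.succ by simp, matTab_apply]
        exact (h4 c').key s s' (by omega) (by rwa [Ne, hbot]) h'
    · rcases matTab_cases M r c with ⟨c', r', rfl, rfl⟩ | h
      · rw [matTab_apply, hrow]
        exact hflag c' r'
      · omega

/-- A flagged key polynomial as a sum over the first column. -/
lemma flaggedKeyPoly_eq_sum (hα : WeakComp α) {n : ℕ} (hN : ∀ i, N < i → α i = 0)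
    (hn : ∀ i, α i ≤ n) (hK : ∀ i, 1 ≤ i → i ≤ N → φ i ≤ K) :
    flaggedKeyPoly α φ = ∑ w : Fin N → Fin (K + 1),
      if (∀ r, w r ≠ ⊥ ↔ 1 ≤ α (r + 1)) ∧ (∀ r, (w r : ℕ) ≤ φ (r + 1)) ∧ ColumnDistinct w then
        (∏ r, entryVar K (w r)) *
          chainSum (entryVar K) n (fun c (r : Fin N) => c + 2 ≤ α (r + 1)) w else 0 := by
  have hsum := sum_chainSum_eq_sum_matrix (entryVar K) n (fun c (r : Fin N) => c + 2 ≤ α (r + 1))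
    fun w => (∀ r, w r ≠ ⊥ ↔ 1 ≤ α (r + 1)) ∧ (∀ r, (w r : ℕ) ≤ φ (r + 1)) ∧ ColumnDistinct w
  refine Eq.trans ?_ (hsum.symm.trans (by congr!))
  have hfilter : (∑ M ∈ Finset.univ.filter (fun M : Fin (n + 1) → Fin N → Fin (K + 1) =>
      matTab M ∈ SSKT α φ), ∏ c, ∏ r, entryVar K (M c r)) = _ :=
    (Finset.sum_filter _ _).trans (Finset.sum_congr rfl fun M _ => if_congr
      ((mem_SSKT_iff hα).trans (keyFilling_matTab_iff hN hn M)) rfl rfl)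
  refine Eq.trans ?_ (hfilter.trans (by congr!))
  rw [← finsum_mem_coe_finset]
  symm
  refine finsum_mem_eq_of_bijOn matTab ⟨fun M hM => ?_, fun M _ M' _ h => ?_, fun T hT => ?_⟩
    fun M _ => (xExp_wtTab_matTab M).symm
  · simpa using hM
  · funext c r
    have := congrFun (congrFun h (r + 1)) (c + 1)
    rwa [matTab_apply, matTab_apply, ← Fin.ext_iff] at this
  · have hT' := hT
    rw [mem_SSKT_iff hα] at hT
    have hrow : ∀ r : Fin N, ((r : ℤ) + 1).toNat = r + 1 := fun r => by omega
    have hle : ∀ (c : Fin (n + 1)) (r : Fin N), T (r + 1) (c + 1) < K + 1 := by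
      intro c r
      have h1 := hT.flag (r + 1) (c + 1)
      have h2 := hK (r + 1) (by omega) (by omega)
      rw [hrow] at h1
      omega
    have hM : matTab (fun c r => ⟨T (r + 1) (c + 1), hle c r⟩) = T := by
      funext r c
      by_cases h : ∃ (c' : Fin (n + 1)) (r' : Fin N), r = r' + 1 ∧ c = c' + 1
      · obtain ⟨c', r', rfl, rfl⟩ := h
        rw [matTab_apply]
      · rw [(matTab_cases _ r c).resolve_left h]
        by_contra h0
        obtain ⟨h1, h2, h3⟩ := (hT.box r c).1 (Ne.symm h0)
        have h6 := hn r.toNat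
        have h7 := hN r.toNat
        exact h ⟨⟨c - 1, by omega⟩, ⟨r.toNat - 1, by omega⟩, by simp only; omega,
          by simp only; omega⟩
    exact ⟨_, by simpa [hM] using hT', hM⟩

end Matrices

section DemazureStep

variable {α φ : ℕ → ℕ} {N t : ℕ}

/-- The column whose entry in row `i` is `i`. -/
def basement (N : ℕ) (r : Fin N) : Fin (N + 1) := r.succ

lemma columnDistinct_basement (N : ℕ) : ColumnDistinct (basement N) := fun _ _ h _ h' =>
  h (Fin.succ_injective N h')

lemma keyStep_basement_iff {p : Fin N → Prop} {w : Fin N → Fin (N + 1)} :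
    KeyStep p (basement N) w ↔
      (∀ r, w r ≠ ⊥ ↔ p r) ∧ (∀ r, (w r : ℕ) ≤ r + 1) ∧ ColumnDistinct w := by
  refine ⟨fun h => ⟨h.support, fun r => h.le r, h.distinct⟩, fun h =>
    ⟨h.1, fun r => h.2.1 r, h.2.2, fun i k hik _ hki => ?_⟩⟩
  exact absurd (Fin.succ_lt_succ_iff.1 hki) hik.not_gt

/-- The flag which differs from the identity only by `t ↦ t + 1`. -/
def bumpFlag (t : ℕ) (l : ℕ) : ℕ := if l = t then t + 1 else l

lemma subE_bumpFlag (t : ℕ) : subE (bumpFlag t) t = id := by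
  funext l
  unfold subE bumpFlag
  split_ifs with h
  · simp [h]
  · rfl

lemma keyStep_swap_basement_iff {p : Fin N → Prop} {w : Fin N → Fin (N + 1)} (ht : 1 ≤ t)
    (htN : t + 1 ≤ N) :
    KeyStep p (basement N) w ∨ KeyStep p (fun r => Equiv.swap (⟨t, by omega⟩ : Fin (N + 1))
        ⟨t + 1, by omega⟩ (basement N r)) w ↔
      (∀ r, w r ≠ ⊥ ↔ p r) ∧ (∀ r, (w r : ℕ) ≤ bumpFlag t (r + 1)) ∧ ColumnDistinct w := by
  have hval : ∀ r : Fin N, ((Equiv.swap (⟨t, by omega⟩ : Fin (N + 1)) ⟨t + 1, by omega⟩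
      (basement N r) : Fin (N + 1)) : ℕ) =
        if (r : ℕ) + 1 = t then t + 1 else if (r : ℕ) = t then t else r + 1 := by
    intro r
    rw [Equiv.swap_apply_def]
    simp only [basement, Fin.ext_iff, Fin.val_succ, Nat.add_right_cancel_iff]
    split_ifs <;> simp
  have hbot : ∀ x : Fin (N + 1), x = ⊥ ↔ (x : ℕ) = 0 := fun x => Fin.ext_iff
  constructor
  · rintro (h | h)
    · obtain ⟨h1, h2, h3⟩ := keyStep_basement_iff.1 h
      refine ⟨h1, fun r => (h2 r).trans ?_, h3⟩
      rw [bumpFlag]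
      split_ifs <;> omega
    · refine ⟨h.support, fun r => ?_, h.distinct⟩
      have h1 : (w r : ℕ) ≤ _ := h.le r
      rw [hval] at h1
      rw [bumpFlag]
      split_ifs at * <;> omega
  · rintro ⟨h1, h2, h3⟩
    by_cases h4 : w ⟨t - 1, by omega⟩ = ⟨t + 1, by omega⟩
    · refine Or.inr ⟨h1, fun r => ?_, h3, fun i k hik hk hki => ?_⟩
      · rw [Fin.le_iff_val_le_val, hval]
        have h5 := h2 r
        rw [bumpFlag] at h5
        by_cases h6 : (r : ℕ) = t
        · have h7 : (w r : ℕ) ≠ t + 1 := fun h7 => by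
            refine h3 ⟨t - 1, by omega⟩ r (fun h8 => ?_) ?_ ?_
            · rw [← h8] at h6
              simp only at h6
              omega
            · rw [h4, Ne, hbot]
              simp
            · rw [h4, Fin.ext_iff, h7]
          split_ifs at * <;> omega
        · split_ifs at * <;> omega
      · rw [Fin.lt_def, hval, hval] at hki
        rw [Fin.lt_def, hval]
        have h6 : (i : ℕ) + 1 = t ∧ (k : ℕ) = t := by
          rw [Fin.lt_def] at hik
          split_ifs at hki <;> omega
        have h7 : i = ⟨t - 1, by omega⟩ := Fin.ext (by simp only; omega)
        rw [h7, h4]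
        split_ifs <;> simp <;> omega
    · refine Or.inl (keyStep_basement_iff.2 ⟨h1, fun r => ?_, h3⟩)
      have h5 := h2 r
      rw [bumpFlag] at h5
      split_ifs at h5 with h6
      · have h7 : r = ⟨t - 1, by omega⟩ := Fin.ext (by simp only; omega)
        rw [← h7, Fin.ext_iff] at h4
        simp only at h4
        omega
      · exact h5

lemma flaggedKeyPoly_id_eq_chainSum (hα : WeakComp α) {n : ℕ} (hN : ∀ i, N < i → α i = 0)
    (hn : ∀ i, α i ≤ n) :
    flaggedKeyPoly α id = chainSum (entryVar N) (n + 1)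
      (fun c (r : Fin N) => c + 1 ≤ α (r + 1)) (basement N) := by
  rw [flaggedKeyPoly_eq_sum hα hN hn (φ := id) (K := N) fun i _ h => h, chainSum]
  refine Finset.sum_congr (by congr!) fun w _ => if_congr ?_ rfl rfl
  rw [keyStep_basement_iff, zero_add]
  rfl

lemma covBy_succ {K t : ℕ} (h : t + 1 < K) : (⟨t, by omega⟩ : Fin K) ⋖ ⟨t + 1, h⟩ := by
  refine ⟨by simp [Fin.lt_def], fun c h1 h2 => ?_⟩
  simp only [Fin.lt_def] at h1 h2
  omega

lemma occursBelow_basement (ht : 1 ≤ t) (htN : t + 1 ≤ N) :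
    OccursBelow (⟨t, by omega⟩ : Fin (N + 1)) ⟨t + 1, by omega⟩ (basement N) := by
  refine ⟨⟨t - 1, by omega⟩, ?_, fun k hk => ?_⟩
  · simp only [basement, Fin.ext_iff, Fin.val_succ]
    omega
  · simp only [basement, Fin.ext_iff, Fin.val_succ] at hk
    simp only [Fin.lt_def]
    omega

lemma exists_basement_eq (htN : t + 1 ≤ N) :
    ∃ r, basement N r = (⟨t + 1, by omega⟩ : Fin (N + 1)) :=
  ⟨⟨t, by omega⟩, rfl⟩

lemma flaggedKeyPoly_bumpFlag_eq_chainSum (hα : WeakComp α) {n : ℕ} (hN : ∀ i, N < i → α i = 0)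
    (hn : ∀ i, α i ≤ n) (ht : 1 ≤ t) (htN : t + 1 ≤ N) :
    flaggedKeyPoly α (bumpFlag t) =
      chainSum (entryVar N) (n + 1) (fun c (r : Fin N) => c + 1 ≤ α (r + 1)) (basement N) +
      chainSum (entryVar N) (n + 1) (fun c (r : Fin N) => c + 1 ≤ α (r + 1)) fun r =>
        Equiv.swap (⟨t, by omega⟩ : Fin (N + 1)) ⟨t + 1, by omega⟩ (basement N r) := by
  rw [flaggedKeyPoly_eq_sum hα hN hn (K := N), chainSum, chainSum, ← Finset.sum_add_distrib]
  swap
  · intro i _ hi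
    rw [bumpFlag]
    split_ifs <;> omega
  refine Finset.sum_congr (by congr!) fun w _ => ?_
  have h1 := keyStep_swap_basement_iff (p := fun r : Fin N => 0 + 1 ≤ α (r + 1)) (w := w) ht htN
  have h2 := not_keyStep_and_swap (p := fun r : Fin N => 0 + 1 ≤ α (r + 1)) (w := w)
    (covBy_succ (show t + 1 < N + 1 by omega)) (fun h => by
      rw [Fin.ext_iff] at h
      exact absurd h (show t ≠ 0 by omega))
    (occursBelow_basement ht htN) (exists_basement_eq htN)
  refine (if_congr h1.symm rfl rfl).trans ?_
  by_cases h3 : KeyStep (fun r : Fin N => 0 + 1 ≤ α (r + 1)) (basement N) w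
  · exact (if_pos (Or.inl h3)).trans ((congrArg₂ (· + ·) (if_pos h3)
      (if_neg fun h => h2 ⟨h3, h⟩)).trans (add_zero _)).symm
  · exact (if_congr (or_iff_right h3) rfl rfl).trans ((congrArg₂ (· + ·) (if_neg h3)
      rfl).trans (zero_add _)).symm

open MvPolynomial in
lemma rename_entryVar (ht : 1 ≤ t) (htN : t + 1 ≤ N) (v : Fin (N + 1)) :
    rename (fun j => sPerm t j) (entryVar N v) =
      entryVar N (Equiv.swap (⟨t, by omega⟩ : Fin (N + 1)) ⟨t + 1, by omega⟩ v) := by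
  have hval : ((Equiv.swap (⟨t, by omega⟩ : Fin (N + 1)) ⟨t + 1, by omega⟩ v : Fin (N + 1)) : ℕ) =
      sPerm t v := by
    rw [sPerm, Equiv.swap_apply_def, Equiv.swap_apply_def]
    simp only [Fin.ext_iff]
    split_ifs <;> rfl
  have h0 : sPerm t v = 0 ↔ (v : ℕ) = 0 := by
    rw [← hval, Equiv.swap_apply_def]
    split_ifs with h1 h2
    · exact iff_of_false id (by rw [h1]; simp only; omega)
    · rw [h2]
      simp only
      omega
    · rfl
  rw [entryVar, entryVar, hval]
  simp only [h0]
  split_ifs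
  · exact map_one _
  · exact rename_X _ _

open MvPolynomial in
lemma X_sub_X_ne_zero (t : ℕ) : (X t - X (t + 1) : MvPolynomial ℕ ℤ) ≠ 0 :=
  sub_ne_zero.2 fun h => by
    have := X_injective h
    omega

open MvPolynomial in
lemma piOp_eq_of_mul_eq {f g : MvPolynomial ℕ ℤ}
    (h : (X t - X (t + 1)) * g = X t * f - X (t + 1) * rename (fun j => sPerm t j) f) :
    piOp t f = g := by
  have hex : g * (X t - X (t + 1)) =
      X t * f - rename (fun j => sPerm t j) (X t * f) := by
    rw [map_mul, rename_X, sPerm, Equiv.swap_apply_left, ← sPerm, mul_comm, h]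
  have hdiv : ∃ g : MvPolynomial ℕ ℤ, g * (X t - X (t + 1)) =
      X t * f - rename (fun j => sPerm t j) (X t * f) := ⟨g, hex⟩
  rw [piOp, divDiff, dif_pos hdiv]
  exact mul_right_cancel₀ (X_sub_X_ne_zero t) (hdiv.choose_spec.trans hex.symm)

/-- Applying an isobaric divided difference operator to a flagged key polynomial. -/
lemma piOp_flaggedKeyPoly (hα : WeakComp α) (ht : 1 ≤ t) (h : α t ≤ α (t + 1)) :
    piOp t (flaggedKeyPoly (swapC α t) id) = flaggedKeyPoly α id := by
  have hb1 : bumpFlag t t = t + 1 := if_pos rfl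
  have hb2 : bumpFlag t (t + 1) = t + 1 := if_neg (by omega)
  have hswap : flaggedKeyPoly α id = flaggedKeyPoly (swapC α t) (bumpFlag t) := by
    rw [← flaggedKeyPoly_swapC hα ht (hb1.trans hb2.symm),
      flaggedKeyPoly_subE hα ht (by omega) (hb1.trans hb2.symm) h, subE_bumpFlag]
  have hγ := hα.swapC ht
  obtain ⟨n, hn, hn'⟩ := hγ.exists_bound
  obtain ⟨N, hN, htN⟩ : ∃ N, n ≤ N ∧ t + 1 ≤ N := ⟨max n (t + 1), by omega, by omega⟩
  have hnN : ∀ i, N < i → swapC α t i = 0 := fun i hi => hn i (by omega)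
  have hcov := covBy_succ (show t + 1 < N + 1 by omega)
  have ha : (⟨t, by omega⟩ : Fin (N + 1)) ≠ ⊥ := fun h => by
    rw [Fin.ext_iff] at h
    exact absurd h (show t ≠ 0 by omega)
  have hya : entryVar N ⟨t, by omega⟩ = MvPolynomial.X t := if_neg (by simp only; omega)
  have hyb : entryVar N ⟨t + 1, by omega⟩ = MvPolynomial.X (t + 1) := if_neg (by simp)
  have hrel := chainSum_demazureRelations
    (s := (MvPolynomial.rename fun j => sPerm t j : _ →ₐ[ℤ] MvPolynomial ℕ ℤ).toRingHom) hcov ha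
    (y := entryVar N) (fun v => rename_entryVar ht htN v) (fun f => ?_) (fun f hf => ?_) (n + 1)
    fun c (r : Fin N) => c + 1 ≤ swapC α t (r + 1)
  · have := hrel.both _ (columnDistinct_basement N) (occursBelow_basement ht htN)
      (exists_basement_eq htN)
    rw [← flaggedKeyPoly_bumpFlag_eq_chainSum hγ hnN hn' ht htN,
      ← flaggedKeyPoly_id_eq_chainSum hγ hnN hn', hya, hyb, ← hswap] at this
    exact piOp_eq_of_mul_eq this
  · change MvPolynomial.rename _ (MvPolynomial.rename _ f) = f
    rw [MvPolynomial.rename_rename]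
    convert MvPolynomial.rename_id_apply f using 2
    congr 1
    funext j
    simp [sPerm]
  · rw [hya, hyb] at hf
    exact (mul_eq_zero.1 hf).resolve_left (X_sub_X_ne_zero t)

end DemazureStep

section Partitions

variable {α : ℕ → ℕ}

lemma WeakComp.comp_perm (hα : WeakComp α) {w : Equiv.Perm ℕ} (hw : w 0 = 0) :
    WeakComp fun j => α (w j) :=
  ⟨by simp only [hw, hα.1], hα.2.preimage w.injective.injOn⟩

lemma conjC_comp_perm (α : ℕ → ℕ) {w : Equiv.Perm ℕ} (hw : w 0 = 0) :
    conjC (fun j => α (w j)) = conjC α := by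
  funext t
  have hw' : ∀ j, 1 ≤ w j ↔ 1 ≤ j := fun j => by
    rw [Nat.one_le_iff_ne_zero, Nat.one_le_iff_ne_zero, ← hw, w.injective.ne_iff, hw]
  have : {j : ℕ | 1 ≤ j ∧ 1 ≤ t ∧ t ≤ α (w j)} = w ⁻¹' {j : ℕ | 1 ≤ j ∧ 1 ≤ t ∧ t ≤ α j} := by
    ext j
    simp [hw']
  rw [conjC, conjC, this, ← Set.ncard_image_of_injective _ w.injective,
    Set.image_preimage_eq _ w.surjective]

lemma sortC_comp_perm (α : ℕ → ℕ) {w : Equiv.Perm ℕ} (hw : w 0 = 0) :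
    sortC (fun j => α (w j)) = sortC α :=
  congrArg conjC (conjC_comp_perm α hw)

lemma ncard_Icc (a b : ℕ) : (Set.Icc a b).ncard = b + 1 - a := by
  rw [← Nat.card_coe_set_eq]
  simp

lemma le_conjC_iff (hα : WeakComp α) (h : AntitoneOn α (Set.Ici 1)) {j t : ℕ} (hj : 1 ≤ j)
    (ht : 1 ≤ t) : j ≤ conjC α t ↔ t ≤ α j := by
  refine ⟨fun hjt => ?_, fun htj => ?_⟩
  · by_contra! h1
    have h2 : conjC α t ≤ (Set.Icc 1 (j - 1)).ncard := by
      refine Set.ncard_le_ncard (fun k hk => ⟨hk.1, ?_⟩) (Set.finite_Icc _ _)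
      by_contra! h3
      have := h (Set.mem_Ici.2 hj) (Set.mem_Ici.2 hk.1) (by omega)
      have := hk.2.2
      omega
    rw [ncard_Icc] at h2
    omega
  · have h2 : (Set.Icc 1 j).ncard ≤ conjC α t := by
      refine Set.ncard_le_ncard (fun k hk => ⟨hk.1, ht, htj.trans ?_⟩)
        (hα.2.subset fun k hk => ?_)
      · exact h (Set.mem_Ici.2 hk.1) (Set.mem_Ici.2 hj) hk.2
      · have := hk.2
        exact Nat.one_le_iff_ne_zero.1 (this.1.trans this.2)
    rw [ncard_Icc] at h2
    omega

lemma sortC_eq_self (hα : WeakComp α) (h : AntitoneOn α (Set.Ici 1)) : sortC α = α := by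
  funext j
  obtain rfl | hj := j.eq_zero_or_pos
  · rw [sortC, conjC, hα.1]
    simp
  · have : {t : ℕ | 1 ≤ t ∧ 1 ≤ j ∧ j ≤ conjC α t} = Set.Icc 1 (α j) := by
      ext t
      refine ⟨fun ht => ⟨ht.1, (le_conjC_iff hα h hj ht.1).1 ht.2.2⟩, fun ht =>
        ⟨ht.1, hj, (le_conjC_iff hα h hj ht.1).2 ht.2⟩⟩
    rw [sortC, conjC, this, ncard_Icc]
    omega

/-- The filling of shape `α` with all entries in row `r` equal to `r`. -/
def rowTab (α : ℕ → ℕ) : Tableau := fun r c =>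
  if 1 ≤ r ∧ 1 ≤ c ∧ c ≤ α r.toNat then r.toNat else 0

lemma keyFilling_rowTab (α : ℕ → ℕ) : KeyFilling α id (rowTab α) where
  box r c := by
    unfold rowTab
    split_ifs with h
    · exact iff_of_true (by omega) h
    · exact iff_of_false (fun h' => h' rfl) h
  row r c hc := by
    unfold rowTab
    split_ifs <;> omega
  col r r' c hr h := by
    unfold rowTab at h ⊢
    split_ifs at h ⊢ <;> omega
  key r r' c hr h h' := by
    unfold rowTab at h h' ⊢
    split_ifs at h h' ⊢ <;> omega
  flag r c := by
    unfold rowTab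
    split_ifs
    · exact le_rfl
    · exact Nat.zero_le _

lemma KeyFilling.eq_rowTab (h : AntitoneOn α (Set.Ici 1)) {T : Tableau}
    (hT : KeyFilling α id T) : T = rowTab α := by
  have key : ∀ n c : ℕ, 1 ≤ n → 1 ≤ c → c ≤ α n → T n c = n := by
    intro n
    induction n using Nat.strong_induction_on with
    | _ n ih =>
      intro c hn hc hcn
      have h1 : T n c ≤ n := hT.flag n c
      have h2 : T n c ≠ 0 := (hT.box n c).2 ⟨by omega, hc, hcn⟩
      by_contra h3
      have h4 := ih (T n c) (by omega) c (by omega) hc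
        (hcn.trans (h (Set.mem_Ici.2 (by omega)) (Set.mem_Ici.2 hn) h1))
      exact hT.col n (T n c) c (by omega) h2 h4.symm
  funext r c
  rw [rowTab]
  split_ifs with hr
  · lift r to ℕ using by omega
    exact key r c (by omega) hr.2.1 hr.2.2
  · by_contra h1
    exact hr ((hT.box r c).1 h1)

lemma wtTab_rowTab (hα : α 0 = 0) : wtTab (rowTab α) = α := by
  funext v
  rw [wtTab]
  split_ifs with hv
  · rw [hv, hα]
  · have : {p : ℤ × ℕ | rowTab α p.1 p.2 = v} =
        (fun c : ℕ => ((v : ℤ), c)) '' Set.Icc 1 (α v) := by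
      ext ⟨r, c⟩
      simp only [Set.mem_image, Set.mem_Icc, Prod.mk.injEq, rowTab]
      constructor
      · intro h
        change (if _ then _ else _) = v at h
        split_ifs at h with h'
        · subst h
          exact ⟨c, h'.2, Int.toNat_of_nonneg (by omega), rfl⟩
        · exact absurd h.symm hv
      · rintro ⟨c, hc, rfl, rfl⟩
        exact if_pos ⟨by omega, hc⟩
    rw [this, Set.ncard_image_of_injective _ fun _ _ h => (Prod.ext_iff.1 h).2, ncard_Icc]
    omega

lemma flaggedKeyPoly_id_of_antitoneOn (hα : WeakComp α) (h : AntitoneOn α (Set.Ici 1)) :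
    flaggedKeyPoly α id = xExp α := by
  have : SSKT α id = {rowTab α} := by
    ext T
    rw [mem_SSKT_iff hα, Set.mem_singleton_iff]
    exact ⟨fun hT => hT.eq_rowTab h, fun hT => hT ▸ keyFilling_rowTab α⟩
  rw [flaggedKeyPoly, this, finsum_mem_singleton, wtTab_rowTab hα.1]

end Partitions

section SortingWords

variable {α : ℕ → ℕ} {i : ℕ} {ρ σ : List ℕ}

lemma wordPerm_cons_apply (i : ℕ) (ρ : List ℕ) (j : ℕ) :
    wordPerm (i :: ρ) j = sPerm i (wordPerm ρ j) := rfl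

lemma posWord_cons : PosWord (i :: ρ) ↔ 1 ≤ i ∧ PosWord ρ := List.forall_mem_cons

lemma sPerm_sPerm (i j : ℕ) : sPerm i (sPerm i j) = j := Equiv.swap_apply_self _ _ _

lemma sPerm_zero (hi : 1 ≤ i) : sPerm i 0 = 0 :=
  Equiv.swap_apply_of_ne_of_ne (by omega) (by omega)

lemma PosWord.wordPerm_zero (h : PosWord ρ) : wordPerm ρ 0 = 0 := by
  induction ρ with
  | nil => rfl
  | cons i ρ ih =>
    rw [wordPerm_cons_apply, ih (posWord_cons.1 h).2, sPerm_zero (posWord_cons.1 h).1]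

lemma sortC_swapC (α : ℕ → ℕ) (hi : 1 ≤ i) : sortC (swapC α i) = sortC α :=
  sortC_comp_perm α (sPerm_zero hi)

lemma antitoneOn_Ici_one (h : ∀ i, 1 ≤ i → α (i + 1) ≤ α i) : AntitoneOn α (Set.Ici 1) := by
  intro i hi j _ hij
  induction j, hij using Nat.le_induction with
  | base => exact le_rfl
  | succ j hij ih => exact (h j (le_trans hi hij)).trans (ih (le_trans hi hij))

/-- Exchanging an ascent lowers the sum of `i * α i`. -/
lemma sum_swapC_lt {N : ℕ} (hi : i + 1 ≤ N) (h : α i < α (i + 1)) :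
    ∑ x ∈ Finset.range (N + 1), x * swapC α i x < ∑ x ∈ Finset.range (N + 1), x * α x := by
  have h1 : i ∈ Finset.range (N + 1) := Finset.mem_range.2 (by omega)
  have h2 : i + 1 ∈ (Finset.range (N + 1)).erase i :=
    Finset.mem_erase.2 ⟨by omega, Finset.mem_range.2 (by omega)⟩
  rw [← Finset.add_sum_erase _ _ h1, ← Finset.add_sum_erase _ _ h2,
    ← Finset.add_sum_erase _ (fun x => x * α x) h1,
    ← Finset.add_sum_erase _ (fun x => x * α x) h2]
  have h3 : ∑ x ∈ ((Finset.range (N + 1)).erase i).erase (i + 1), x * swapC α i x =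
      ∑ x ∈ ((Finset.range (N + 1)).erase i).erase (i + 1), x * α x := by
    refine Finset.sum_congr rfl fun x hx => ?_
    simp only [Finset.mem_erase] at hx
    rw [swapC, sPerm, Equiv.swap_apply_of_ne_of_ne hx.2.1 hx.1]
  have h4 : swapC α i i = α (i + 1) := congrArg α (Equiv.swap_apply_left _ _)
  have h5 : swapC α i (i + 1) = α i := congrArg α (Equiv.swap_apply_right _ _)
  simp only [h3, h4, h5]
  nlinarith

lemma exists_antitoneOn_wordPerm (hα : WeakComp α) :
    ∃ ρ, PosWord ρ ∧ AntitoneOn (fun j => α (wordPerm ρ j)) (Set.Ici 1) := by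
  obtain ⟨N, hN, -⟩ := hα.exists_bound
  induction hM : ∑ x ∈ Finset.range (N + 1), x * α x using Nat.strong_induction_on
    generalizing α with
  | _ M ih =>
    by_cases h : ∀ i, 1 ≤ i → α (i + 1) ≤ α i
    · exact ⟨[], fun x hx => absurd hx List.not_mem_nil, antitoneOn_Ici_one h⟩
    push Not at h
    obtain ⟨i, hi, h⟩ := h
    have hiN : i + 1 ≤ N := by
      by_contra! h1
      rw [hN _ h1] at h
      omega
    obtain ⟨ρ, hρ, hρ'⟩ := ih _ (hM ▸ sum_swapC_lt hiN h) (hα.swapC hi) (fun j hj => by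
      rw [swapC, sPerm, Equiv.swap_apply_of_ne_of_ne (by omega) (by omega), hN j hj]) rfl
    exact ⟨i :: ρ, posWord_cons.2 ⟨hi, hρ⟩, hρ'⟩

/-- The words whose permutations rearrange `α` into a partition. -/
def SortingWord (α : ℕ → ℕ) (ρ : List ℕ) : Prop :=
  PosWord ρ ∧ ∀ j, α (wordPerm ρ j) = sortC α j

lemma exists_sortingWord (hα : WeakComp α) :
    ∃ ρ, SortingWord α ρ ∧ AntitoneOn (sortC α) (Set.Ici 1) := by
  obtain ⟨ρ, hρ, h⟩ := exists_antitoneOn_wordPerm hα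
  have : sortC α = fun j => α (wordPerm ρ j) := by
    rw [← sortC_comp_perm α hρ.wordPerm_zero,
      sortC_eq_self (hα.comp_perm hρ.wordPerm_zero) h]
  exact ⟨ρ, ⟨hρ, fun j => (congrFun this j).symm⟩, this ▸ h⟩

lemma sortingWord_cons (hi : 1 ≤ i) : SortingWord α (i :: ρ) ↔ SortingWord (swapC α i) ρ := by
  rw [SortingWord, SortingWord, posWord_cons, sortC_swapC α hi]
  exact and_congr_left' (and_iff_right hi)

/-- A word sorting a composition can be shortened after exchanging two increasing entries. -/
lemma exists_shorter_word {β : ℕ → ℕ} {p q : ℕ} (hp : 1 ≤ p) (hpq : p < q) (hβ : β p < β q)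
    (hσ : PosWord σ) (h : AntitoneOn (fun j => β (wordPerm σ j)) (Set.Ici 1)) :
    ∃ σ', PosWord σ' ∧ σ'.length + 1 = σ.length ∧
      ∀ j, β (Equiv.swap p q (wordPerm σ' j)) = β (wordPerm σ j) := by
  induction σ generalizing β p q with
  | nil => exact absurd hβ (h (Set.mem_Ici.2 hp) (Set.mem_Ici.2 (hp.trans hpq.le)) hpq.le).not_gt
  | cons i σ ih =>
    obtain ⟨hi, hσ₁⟩ := posWord_cons.1 hσ
    by_cases hpi : p = i ∧ q = i + 1
    · obtain ⟨rfl, rfl⟩ := hpi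
      exact ⟨σ, hσ₁, rfl, fun j => rfl⟩
    have hlt : 1 ≤ sPerm i p ∧ sPerm i p < sPerm i q := by
      unfold sPerm
      rw [Equiv.swap_apply_def, Equiv.swap_apply_def]
      split_ifs <;> omega
    obtain ⟨σ', hσ', hlen, h'⟩ := ih (β := swapC β i) hlt.1 hlt.2
      (by rwa [swapC, swapC, sPerm_sPerm, sPerm_sPerm]) hσ₁ h
    refine ⟨i :: σ', posWord_cons.2 ⟨hi, hσ'⟩, by simp [hlen], fun j => ?_⟩
    refine Eq.trans (congrArg β ?_) (h' j)
    rw [Equiv.swap_apply_apply, wordPerm_cons_apply, Equiv.Perm.mul_apply, Equiv.Perm.mul_apply,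
      sPerm_sPerm]
    rfl

/-- The exchange property for a shortest word sorting `α`. -/
lemma SortingWord.le_of_minimal (hα : WeakComp α) (hi : 1 ≤ i) (h : SortingWord α (i :: ρ))
    (hmin : ∀ σ, SortingWord α σ → (i :: ρ).length ≤ σ.length) : α i ≤ α (i + 1) := by
  by_contra! hlt
  obtain ⟨-, -, hanti⟩ := exists_sortingWord hα
  obtain ⟨hρ, hsort⟩ := (sortingWord_cons hi).1 h
  rw [sortC_swapC α hi] at hsort
  obtain ⟨σ, hσ, hlen, hσ'⟩ := exists_shorter_word (β := swapC α i) hi (Nat.lt_succ_self i)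
    (by rwa [swapC, swapC, sPerm, Equiv.swap_apply_left, Equiv.swap_apply_right]) hρ
    ((funext hsort : (fun j => swapC α i (wordPerm ρ j)) = sortC α) ▸ hanti)
  have := hmin σ ⟨hσ, fun j => by
    rw [← hsort, ← hσ']
    exact congrArg α (sPerm_sPerm i _).symm⟩
  rw [List.length_cons] at this
  omega

lemma piWord_xExp_sortC (hα : WeakComp α) (h : SortingWord α ρ)
    (hmin : ∀ σ, SortingWord α σ → ρ.length ≤ σ.length) :
    piWord ρ (xExp (sortC α)) = flaggedKeyPoly α id := by
  induction ρ generalizing α with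
  | nil =>
    have h1 : α = sortC α := funext h.2
    obtain ⟨-, -, hanti⟩ := exists_sortingWord hα
    rw [piWord, flaggedKeyPoly_id_of_antitoneOn hα (h1 ▸ hanti), ← h1]
  | cons i ρ ih =>
    have hi := (posWord_cons.1 h.1).1
    rw [piWord, ← sortC_swapC α hi, ih (hα.swapC hi) ((sortingWord_cons hi).1 h) fun σ hσ =>
      Nat.le_of_succ_le_succ (hmin (i :: σ) ((sortingWord_cons hi).2 hσ))]
    exact piOp_flaggedKeyPoly hα hi (h.le_of_minimal hα hi hmin)

lemma exists_word_of_permLength (hρ : PosWord ρ) :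
    ∃ σ, PosWord σ ∧ wordPerm σ = wordPerm ρ ∧ σ.length = permLength (wordPerm ρ) :=
  Nat.sInf_mem (s := {n | ∃ σ, PosWord σ ∧ wordPerm σ = wordPerm ρ ∧ σ.length = n})
    ⟨_, ρ, hρ, rfl, rfl⟩

lemma permLength_le (hρ : PosWord ρ) : permLength (wordPerm ρ) ≤ ρ.length :=
  Nat.sInf_le ⟨ρ, hρ, rfl, rfl⟩

lemma isReducedWord_iff : IsReducedWord ρ ↔ PosWord ρ ∧ ρ.length = permLength (wordPerm ρ) := by
  refine and_congr_right fun hρ => ⟨fun h => ?_, fun h σ hσ hσρ => ?_⟩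
  · obtain ⟨σ, hσ, hσρ, hlen⟩ := exists_word_of_permLength hρ
    exact le_antisymm (hlen ▸ h σ hσ hσρ) (permLength_le hρ)
  · rw [h, ← hσρ]
    exact permLength_le hσ

lemma sortingWord_minimal_iff (α : ℕ → ℕ) (ρ : List ℕ) :
    (∃ w : Equiv.Perm ℕ, IsReducedWordFor w ρ ∧ (∀ i, α (w i) = sortC α i) ∧
      ∀ v : Equiv.Perm ℕ, (∃ τ, IsReducedWordFor v τ) → (∀ i, α (v i) = sortC α i) →
        permLength w ≤ permLength v) ↔
    SortingWord α ρ ∧ ∀ σ, SortingWord α σ → ρ.length ≤ σ.length := by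
  constructor
  · rintro ⟨_, ⟨hρ, rfl⟩, hsort, hmin⟩
    obtain ⟨hpos, hlen⟩ := isReducedWord_iff.1 hρ
    refine ⟨⟨hpos, hsort⟩, fun σ hσ => ?_⟩
    obtain ⟨τ, hτ, hτσ, hτlen⟩ := exists_word_of_permLength hσ.1
    rw [hlen]
    exact (hmin (wordPerm σ) ⟨τ, isReducedWord_iff.2 ⟨hτ, by rw [hτlen, hτσ]⟩, hτσ⟩ hσ.2).trans
      (permLength_le hσ.1)
  · rintro ⟨⟨hpos, hsort⟩, hmin⟩
    refine ⟨wordPerm ρ, ⟨⟨hpos, fun σ hσ hσρ => hmin σ ⟨hσ, hσρ ▸ hsort⟩⟩, rfl⟩, hsort, ?_⟩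
    rintro _ ⟨τ, hτ, rfl⟩ hτsort
    obtain ⟨hτpos, hτlen⟩ := isReducedWord_iff.1 hτ
    rw [← hτlen]
    exact (permLength_le hpos).trans (hmin τ ⟨hτpos, hτsort⟩)

theorem keyPoly_eq_flaggedKeyPoly (hα : WeakComp α) : keyPoly α = flaggedKeyPoly α id := by
  have hex : ∃ ρ, SortingWord α ρ ∧ ∀ σ, SortingWord α σ → ρ.length ≤ σ.length := by
    obtain ⟨ρ, hρ, -⟩ := exists_sortingWord hα
    obtain ⟨_, ⟨σ, hσ, rfl⟩, hmin⟩ := WellFounded.has_min (wellFounded_lt (α := ℕ))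
      (List.length '' {σ | SortingWord α σ}) ⟨_, ρ, hρ, rfl⟩
    exact ⟨σ, hσ, fun τ hτ => not_lt.1 (hmin _ ⟨τ, hτ, rfl⟩)⟩
  have h := hex
  simp only [← sortingWord_minimal_iff] at h
  rw [keyPoly, dif_pos h]
  obtain ⟨h1, h2⟩ := (sortingWord_minimal_iff α h.choose).1 h.choose_spec
  exact piWord_xExp_sortC hα h1 h2

end SortingWords

/-- Theorem `recursion`.
If `φ` is strictly increasing then `κ_{(α,φ)} = κ_β` with `β_j = α_i` when `j = φ(i)` and
`β_j = 0` otherwise.  If `φ` is not strictly increasing and `i` is the smallest index with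
`φ(i) = φ(i+1)`, then `κ_{(α,φ)} = κ_{(α, φ-e_i)}` when `α_i ≤ α_{i+1}` and
`κ_{(α,φ)} = κ_{(α·s_i, φ-e_i)}` when `α_i > α_{i+1}`. -/
theorem flagged_key_recursion (α : ℕ → ℕ) (hα : WeakComp α) (φ : ℕ → ℕ) (hφ : IsFlag φ) :
    ((∀ m, 1 ≤ m → φ m < φ (m + 1)) →
      flaggedKeyPoly α φ =
        keyPoly (fun j => if ∃ i, 1 ≤ i ∧ φ i = j
          then α (sInf {i : ℕ | 1 ≤ i ∧ φ i = j}) else 0)) ∧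
    (∀ i : ℕ, 1 ≤ i → φ i = φ (i + 1) → (∀ m, 1 ≤ m → φ m = φ (m + 1) → i ≤ m) →
      ((α i ≤ α (i + 1) → flaggedKeyPoly α φ = flaggedKeyPoly α (subE φ i)) ∧
       (α (i + 1) < α i → flaggedKeyPoly α φ = flaggedKeyPoly (swapC α i) (subE φ i)))) := by
  have hφ1 : ∀ i, 1 ≤ i → 1 ≤ φ i := fun i hi => hi.trans (hφ.2 i hi)
  refine ⟨fun hmono => ?_, fun i hi hφi _ => ⟨fun h => ?_, fun h => ?_⟩⟩
  · set β : ℕ → ℕ := fun j => if ∃ i, 1 ≤ i ∧ φ i = j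
      then α (sInf {i : ℕ | 1 ≤ i ∧ φ i = j}) else 0 with hβdef
    have hlt : ∀ i j, 1 ≤ i → i < j → φ i < φ j := fun i j hi hij => by
      induction j, hij using Nat.le_induction with
      | base => exact hmono i hi
      | succ j hij ih => exact ih.trans (hmono j (by omega))
    have hinj : ∀ i j, 1 ≤ i → 1 ≤ j → φ i = φ j → i = j := fun i j hi hj hij => by
      by_contra hne
      rcases Nat.lt_or_gt_of_ne hne with h | h
      · exact (hlt i j hi h).ne hij
      · exact (hlt j i hj h).ne' hij
    have hβφ : ∀ i, 1 ≤ i → β (φ i) = α i := fun i hi => by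
      have hset : {k : ℕ | 1 ≤ k ∧ φ k = φ i} = {i} := by
        ext k
        exact ⟨fun hk => hinj k i hk.1 hi hk.2, fun hk => by rw [Set.mem_singleton_iff.1 hk]; exact ⟨hi, rfl⟩⟩
      rw [hβdef]
      simp only [hset, csInf_singleton]
      exact if_pos ⟨i, hi, rfl⟩
    have hβ0 : ∀ j, β j ≠ 0 → ∃ i, 1 ≤ i ∧ φ i = j := fun j hj => by
      by_contra h
      exact hj (if_neg h)
    have hβ : WeakComp β := by
      refine ⟨?_, (hα.2.image φ).subset fun j hj => ?_⟩
      · by_contra h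
        obtain ⟨i, hi, h⟩ := hβ0 0 h
        exact absurd (hφ1 i hi) (by omega)
      · obtain ⟨i, hi, rfl⟩ := hβ0 j hj
        exact ⟨i, fun h0 => hj ((hβφ i hi).trans h0), rfl⟩
    rw [keyPoly_eq_flaggedKeyPoly hβ]
    exact flaggedKeyPoly_of_strictMono hα hβ hφ1 hmono hβφ hβ0
  · exact flaggedKeyPoly_subE hα hi (hφ1 i hi) hφi h
  · rw [flaggedKeyPoly_swapC hα hi hφi]
    refine flaggedKeyPoly_subE (hα.swapC hi) hi (hφ1 i hi) hφi ?_
    rw [swapC, swapC, sPerm, Equiv.swap_apply_left, Equiv.swap_apply_right]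
    exact h.le

end
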